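/- For n ≥ 1, the q-binomial-Eulerian polynomial satisfies Ã_n(t,q) = ∑_{π ∈ PRW_{n+1}} t^{des(π)} q^{ai(π)}, where PRW_{n+1} is the set of permutations of [n+1] whose first ascent (if any) occurs at the letter 1, and ai counts admissible inversions. -/

import Mathlib

open Finset

/-- A permutation of `Fin n` viewed as a function `ℕ → ℕ` (0-based), identity outside. -/
def pf {n : ℕ} (π : Equiv.Perm (Fin n)) (i : ℕ) : ℕ :=
  if h : i < n then (π ⟨i, h⟩ : ℕ) else i

/-- Number of descents. -/
def desN {n : ℕ} (π : Equiv.Perm (Fin n)) : ℕ :=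
  ((range (n - 1)).filter (fun i => pf π (i + 1) < pf π i)).card

/-- Number of inversions. -/
def invN {n : ℕ} (π : Equiv.Perm (Fin n)) : ℕ :=
  (((range n) ×ˢ (range n)).filter (fun p => p.1 < p.2 ∧ pf π p.2 < pf π p.1)).card

/-- Number of excedances. -/
def excN {n : ℕ} (π : Equiv.Perm (Fin n)) : ℕ :=
  ((range n).filter (fun i => i < pf π i)).card

/-- Major index. -/
def majN {n : ℕ} (π : Equiv.Perm (Fin n)) : ℕ :=
  ∑ i ∈ (range (n - 1)).filter (fun i => pf π (i + 1) < pf π i), (i + 1)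

/-- Number of admissible inversions. -/
def aiN {n : ℕ} (π : Equiv.Perm (Fin n)) : ℕ :=
  (((range n) ×ˢ (range n)).filter (fun p => p.1 < p.2 ∧ pf π p.2 < pf π p.1 ∧
    ((0 < p.1 ∧ pf π (p.1 - 1) < pf π p.1) ∨ ∃ k < p.2, p.1 < k ∧ pf π p.1 < pf π k))).card

/-- The classical Eulerian polynomial `A_n(t) = ∑_{π ∈ S_n} t^{des π}`. -/
def eulerPoly (R : Type*) [CommRing R] (n : ℕ) (t : R) : R :=
  ∑ π : Equiv.Perm (Fin n), t ^ desN π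

/-- The (maj, exc) q-Eulerian polynomial `A_n(t,q)`. -/
def Aq (R : Type*) [CommRing R] (n : ℕ) (t q : R) : R :=
  ∑ π : Equiv.Perm (Fin n), t ^ excN π * q ^ (majN π - excN π)

/-- The Gaussian binomial coefficient (as a value at `q`), via the q-Pascal recurrence. -/
def gaussR {R : Type*} [CommRing R] (q : R) : ℕ → ℕ → R
  | _, 0 => 1
  | 0, _ + 1 => 0
  | n + 1, k + 1 => gaussR q n k + q ^ (k + 1) * gaussR q n (k + 1)

/-- The q-binomial-Eulerian polynomial `Ã_n(t,q)`. -/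
def Atilde (R : Type*) [CommRing R] (n : ℕ) (t q : R) : R :=
  1 + t * ∑ m ∈ Icc 1 n, gaussR q n m * Aq R m t q

/-- Membership in PRW: if the permutation has an ascent, then the first ascent
carries the smallest letter. -/
def isPRW {n : ℕ} (π : Equiv.Perm (Fin n)) : Prop :=
  ∀ i < n, i + 1 < n → pf π i < pf π (i + 1) →
    (∀ j < i, ¬ pf π j < pf π (j + 1)) → pf π i = 0

instance {n : ℕ} : DecidablePred (isPRW (n := n)) := fun _ => by
  unfold isPRW; infer_instance

/-- 1-based entries with boundary convention `σ₀ = σ_{n+1} = +∞` (encoded as `n`). -/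
def extv {n : ℕ} (π : Equiv.Perm (Fin n)) (i : ℕ) : ℕ :=
  if 1 ≤ i ∧ i ≤ n then pf π (i - 1) else n

/-- Number of non-initial double descents. -/
def ddN {n : ℕ} (π : Equiv.Perm (Fin n)) : ℕ :=
  ((Icc 2 n).filter (fun i => extv π (i + 1) < extv π i ∧ extv π i < extv π (i - 1))).card


section MMT
set_option linter.unusedSectionVars false
open Matrix

variable {ι : Type*} [Fintype ι] [DecidableEq ι]

/-- generalized permutation sums -/
def SG (n : ℕ) (F : Fin n → Matrix ι ι ℝ) : ℝ :=
  ∑ σ : Equiv.Perm (Fin n), ∑ c : Fin n → ι, ∏ i, F i (c i) (c (σ i))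


lemma SG_comp {n : ℕ} (F : Fin n → Matrix ι ι ℝ) (ρ : Equiv.Perm (Fin n)) :
    SG n (F ∘ ρ) = SG n F := by
  unfold SG
  refine Fintype.sum_equiv (MulAut.conj ρ).toEquiv _ _ fun σ => ?_
  refine Fintype.sum_equiv (Equiv.arrowCongr ρ (Equiv.refl ι)) _ _ fun c => ?_
  refine Fintype.prod_equiv ρ _ _ fun i => ?_
  simp [Equiv.arrowCongr]

lemma SG_insert {n : ℕ} (A : Matrix ι ι ℝ) (F : Fin n → Matrix ι ι ℝ) :
    SG (n + 1) (Fin.cons A F : Fin (n+1) → Matrix ι ι ℝ) =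
      A.trace * SG n F + ∑ j, SG n (Function.update F j (F j * A)) := by
  unfold SG
  rw [← Equiv.Perm.decomposeFin.symm.sum_comp, Fintype.sum_prod_type, Fin.sum_univ_succ]
  congr 1
  · rw [Finset.mul_sum]
    refine Finset.sum_congr rfl fun σ _ => ?_
    rw [← (Fin.consEquiv (fun _ : Fin (n+1) => ι)).sum_comp, Fintype.sum_prod_type]
    rw [Matrix.trace, Finset.sum_mul]
    refine Finset.sum_congr rfl fun a _ => ?_
    rw [Finset.mul_sum]
    refine Finset.sum_congr rfl fun c _ => ?_
    rw [Fin.prod_univ_succ]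
    simp [Fin.consEquiv]
  · rw [Finset.sum_comm]
    conv_rhs => rw [Finset.sum_comm]
    refine Finset.sum_congr rfl fun σ _ => ?_
    rw [← Equiv.sum_comp σ]
    refine Finset.sum_congr rfl fun i₀ _ => ?_
    rw [← (Fin.consEquiv (fun _ : Fin (n+1) => ι)).sum_comp, Fintype.sum_prod_type, Finset.sum_comm]
    refine Finset.sum_congr rfl fun c _ => ?_
    rw [← Finset.mul_prod_erase _ _ (Finset.mem_univ i₀)]
    simp only [Function.update_self, Matrix.mul_apply, Finset.sum_mul]
    refine Finset.sum_congr rfl fun a _ => ?_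
    rw [Fin.prod_univ_succ, ← Finset.mul_prod_erase _ _ (Finset.mem_univ i₀)]
    have h1 : ∀ i ∈ Finset.univ.erase i₀, (Function.update F i₀ (F i₀ * A)) i (c i) (c (σ i))
        = (Fin.cons A F : Fin (n+1) → Matrix ι ι ℝ) i.succ
          ((Fin.consEquiv (fun _ => ι)) (a, c) i.succ)
          ((Fin.consEquiv (fun _ => ι)) (a, c)
            ((Equiv.Perm.decomposeFin.symm ((σ i₀).succ, σ)) i.succ)) := by
      intro i hi
      have hi' : i ≠ i₀ := Finset.ne_of_mem_erase hi
      have : Equiv.swap 0 (σ i₀).succ (σ i).succ = (σ i).succ := by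
        apply Equiv.swap_apply_of_ne_of_ne (Fin.succ_ne_zero _)
        simpa using hi'
      simp [Fin.consEquiv, Function.update_of_ne hi', this]
    rw [Finset.prod_congr rfl h1]
    simp [Fin.consEquiv]
    ring

/-- normalized sums -/
noncomputable def sn (M : Matrix ι ι ℝ) (n : ℕ) : ℝ := SG n (fun _ => M) / n.factorial

lemma SG_newton (M : Matrix ι ι ℝ) (n : ℕ) : ∀ k,
    SG (n + 1) (Fin.cons (M ^ k) (fun _ => M) : Fin (n+1) → Matrix ι ι ℝ) / n.factorial =
      ∑ j ∈ Finset.range (n + 1), (M ^ (k + j)).trace * sn M (n - j) := by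
  induction n with
  | zero =>
    intro k
    rw [SG_insert]
    simp [sn]
  | succ n ih =>
    intro k
    rw [SG_insert]
    have h : ∀ j : Fin (n + 1), SG (n + 1) (Function.update (fun _ => M) j (M * M ^ k)) =
        SG (n + 1) (Fin.cons (M ^ (k + 1)) (fun _ => M) : Fin (n+1) → Matrix ι ι ℝ) := by
      intro j
      rw [← SG_comp _ (Equiv.swap 0 j)]
      congr 1
      funext i
      rw [← pow_succ']
      by_cases hi : i = 0
      · subst hi; simp
      · obtain ⟨i', rfl⟩ := Fin.exists_succ_eq.mpr hi
        simp only [Function.comp, Fin.cons_succ]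
        rw [Function.update_of_ne]
        intro h
        apply hi
        have := congrArg (Equiv.swap 0 j) h
        simp at this
    rw [Finset.sum_congr rfl fun j _ => h j]
    rw [Finset.sum_const, Finset.card_univ, Fintype.card_fin, Finset.sum_range_succ']
    have := ih (k + 1)
    have hf : (n.factorial : ℝ) ≠ 0 := by positivity
    have hf' : ((n : ℝ) + 1) ≠ 0 := by positivity
    rw [add_div, add_comm]
    congr 1
    · have e : ∀ j ∈ Finset.range (n+1), (M ^ (k + (j + 1))).trace * sn M (n + 1 - (j + 1)) =
          (M ^ (k + 1 + j)).trace * sn M (n - j) := by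
        intro j _
        rw [show k + (j + 1) = k + 1 + j by ring, Nat.add_sub_add_right]
      rw [Finset.sum_congr rfl e, ← this, Nat.factorial_succ]
      push_cast
      rw [nsmul_eq_mul]
      push_cast
      field_simp
    · simp [sn, mul_div_assoc]

lemma sn_newton (M : Matrix ι ι ℝ) (n : ℕ) :
    (n + 1 : ℝ) * sn M (n + 1) =
      ∑ j ∈ Finset.range (n + 1), (M ^ (j + 1)).trace * sn M (n - j) := by
  have h := SG_newton M n 1
  have e : (Fin.cons (M ^ 1) (fun _ => M) : Fin (n+1) → Matrix ι ι ℝ) = fun _ => M := by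
    funext i; refine Fin.cases ?_ (fun i => ?_) i <;> simp
  rw [e] at h
  have : ∀ j, M ^ (1 + j) = M ^ (j + 1) := fun j => by rw [add_comm]
  simp only [this] at h
  rw [← h, sn, Nat.factorial_succ]
  have hf : (n.factorial : ℝ) ≠ 0 := by positivity
  have hf' : ((n : ℝ) + 1) ≠ 0 := by positivity
  push_cast
  field_simp

open PowerSeries in
lemma deriv_prod (s : Finset ι) (f : ι → ℝ⟦X⟧) :
    d⁄dX ℝ (∏ i ∈ s, f i) = ∑ i ∈ s, (∏ j ∈ s.erase i, f j) * d⁄dX ℝ (f i) := by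
  induction s using Finset.induction_on with
  | empty => simp
  | insert a s ha ih =>
    rw [Finset.prod_insert ha, Derivation.leibniz, ih, Finset.sum_insert ha,
      Finset.erase_insert ha, smul_eq_mul, smul_eq_mul, Finset.mul_sum, add_comm]
    congr 1
    refine Finset.sum_congr rfl fun i hi => ?_
    have hia : a ≠ i := fun h => ha (h ▸ hi)
    rw [Finset.erase_insert_of_ne hia, Finset.prod_insert
      (fun h => ha (Finset.mem_of_mem_erase h)), mul_assoc]

open PowerSeries in
lemma deriv_det (A : Matrix ι ι ℝ⟦X⟧) (B : Matrix ι ι ℝ⟦X⟧)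
    (hB : ∀ i j, d⁄dX ℝ (A i j) = (B * A) i j) :
    d⁄dX ℝ A.det = B.trace * A.det := by
  have h1 : d⁄dX ℝ A.det = ∑ i, (A.updateRow i (fun j => d⁄dX ℝ (A i j))).det := by
    simp only [Matrix.det_apply]
    rw [map_sum, Finset.sum_comm]
    refine Finset.sum_congr rfl fun σ _ => ?_
    rw [← Finset.smul_sum, Units.smul_def, Units.smul_def, map_zsmul, deriv_prod]
    congr 1
    conv_rhs => rw [← Equiv.sum_comp σ]
    refine Finset.sum_congr rfl fun i _ => ?_
    rw [mul_comm]
    refine Eq.trans ?_ (Finset.mul_prod_erase _ _ (Finset.mem_univ i))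
    rw [Matrix.updateRow_self]
    congr 1
    refine Finset.prod_congr rfl fun j hj => ?_
    rw [Matrix.updateRow_ne]
    exact fun h => Finset.ne_of_mem_erase hj (σ.injective h)
  rw [h1, Matrix.trace, Finset.sum_mul]
  refine Finset.sum_congr rfl fun i _ => ?_
  have : (fun j => d⁄dX ℝ (A i j)) = ∑ k, B i k • A k := by
    funext j
    rw [hB, Matrix.mul_apply]
    simp
  rw [this, Matrix.det_updateRow_sum]
  simp

open PowerSeries in
/-- MacMahon master theorem -/
lemma mmt (M : Matrix ι ι ℝ) :
    PowerSeries.mk (sn M) * (1 - (X : ℝ⟦X⟧) • M.map (C : ℝ →+* ℝ⟦X⟧)).det = 1 := by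
  set A : Matrix ι ι ℝ⟦X⟧ := 1 - (X : ℝ⟦X⟧) • M.map (C : ℝ →+* ℝ⟦X⟧) with hA
  set T : ℝ⟦X⟧ := PowerSeries.mk fun k => (M ^ (k + 1)).trace with hT
  have hs : d⁄dX ℝ (PowerSeries.mk (sn M)) = T * PowerSeries.mk (sn M) := by
    ext n
    rw [PowerSeries.coeff_derivative, PowerSeries.coeff_mul, Finset.Nat.sum_antidiagonal_eq_sum_range_succ_mk]
    simp only [hT, PowerSeries.coeff_mk]
    rw [← sn_newton]; ring
  set B : Matrix ι ι ℝ⟦X⟧ := Matrix.of fun i j => - PowerSeries.mk fun k => (M ^ (k + 1)) i j with hB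
  have hBA : ∀ i j, d⁄dX ℝ (A i j) = (B * A) i j := by
    intro i j
    have h1 : (B * A) i j = - C (M i j) := by
      rw [hA, mul_sub, mul_one, Matrix.mul_smul]
      ext n
      rw [Matrix.sub_apply, Matrix.smul_apply, smul_eq_mul, map_sub]
      cases n with
      | zero =>
        simp [hB]
      | succ n =>
        rw [PowerSeries.coeff_succ_X_mul, Matrix.mul_apply, map_sum]
        simp only [hB, Matrix.of_apply, Matrix.map_apply, PowerSeries.coeff_mul_C, map_neg, PowerSeries.coeff_mk,
          PowerSeries.coeff_C]
        rw [pow_succ M (n+1), Matrix.mul_apply]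
        simp
    rw [h1, hA, Matrix.sub_apply, Matrix.smul_apply, map_sub]
    have : d⁄dX ℝ ((1 : Matrix ι ι ℝ⟦X⟧) i j) = 0 := by
      by_cases h : i = j
      · subst h; simp
      · simp [h]
    rw [this]
    simp
  have hd := deriv_det A B hBA
  have htr : B.trace = - T := by
    ext n
    simp [hB, hT, Matrix.trace]
  apply PowerSeries.derivative.ext
  · rw [Derivation.leibniz, hd, hs, htr]
    simp
    ring
  · rw [map_mul, RingHom.map_det]
    have : (PowerSeries.constantCoeff (R := ℝ)).mapMatrix A = 1 := by
      ext i j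
      simp [hA]
      by_cases h : i = j
      · subst h; simp
      · simp [h]
    rw [this]
    simp [sn, SG]
end MMT

section DetPart
open Matrix

lemma sum_tele {P : Type*} [CommRing P] (Z : ℕ → P) (m l : ℕ) (hl : l ≤ m) :
    ∑ j : Fin m, (if (j : ℕ) < l then Z j - Z (j + 1) else 0) = Z 0 - Z l := by
  rw [Fin.sum_univ_eq_sum_range (fun j => if j < l then Z j - Z (j + 1) else 0) m]
  rw [← Finset.sum_filter]
  have : (Finset.range m).filter (fun j => j < l) = Finset.range l := by
    ext j; simp; omega
  rw [this, Finset.sum_range_sub']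

def AM {P : Type*} [CommRing P] (m : ℕ) (a : ℕ → P) : Matrix (Fin m) (Fin m) P :=
  Matrix.of fun l j => if Odd (l : ℕ) then (if j ≤ l then a l else 0) else
    (if l ≤ j then a l else 0)

lemma det_AM {P : Type*} [CommRing P] (m : ℕ) (a Z : ℕ → P) (h0 : Z 0 = 1)
    (he : ∀ l, ¬ Odd l → Z (l + 1) = (1 - a l) * Z l)
    (ho : ∀ l, Odd l → (1 - a l) * Z (l + 1) = Z l - a l) :
    (1 - AM m a).det = (∏ l ∈ Finset.range m, if Odd l then 1 - a l else 1) * Z m := by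
  set L : Matrix (Fin m) (Fin m) P := Matrix.of fun l j =>
    (if l = j then 1 else 0) + (if Odd (l : ℕ) then (if (j : ℕ) < l + 1 then - a l else 0) else
      (if (j : ℕ) < l then a l else 0)) with hL
  set y : Fin m → P := fun j => Z j - Z (j + 1) with hy
  have hLy : ∀ l : Fin m, ∑ j, L l j * y j = if Odd (l : ℕ) then 0 else a l := by
    intro l
    simp only [hL, Matrix.of_apply, add_mul, Finset.sum_add_distrib]
    have h1 : ∑ j, (if l = j then (1 : P) else 0) * y j = Z l - Z (l + 1) := by
      simp [hy]
    rw [h1]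
    by_cases hl : Odd (l : ℕ)
    · simp only [hl, if_true]
      have := sum_tele Z m (l + 1) l.2
      have h2 : ∑ j : Fin m, (if (j : ℕ) < l + 1 then - a l else 0) * y j =
          - a l * (Z 0 - Z (l + 1)) := by
        rw [← this, Finset.mul_sum]
        refine Finset.sum_congr rfl fun j _ => ?_
        split_ifs <;> simp [hy]
      rw [h2, h0]
      have := ho l hl
      linear_combination -this
    · simp only [hl, if_false]
      have := sum_tele Z m l l.2.le
      have h2 : ∑ j : Fin m, (if (j : ℕ) < l then a l else 0) * y j =
          a l * (Z 0 - Z l) := by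
        rw [← this, Finset.mul_sum]
        refine Finset.sum_congr rfl fun j _ => ?_
        split_ifs <;> simp [hy]
      rw [h2, h0]
      have := he l hl
      linear_combination -this
  have key : 1 - AM m a = L * (1 + replicateCol Unit (fun j => - y j) * replicateRow Unit (fun _ : Fin m => (1 : P))) := by
    rw [mul_add, mul_one, ← Matrix.mul_assoc]
    ext l j
    have h3 : (L * replicateCol Unit (fun j => - y j) * replicateRow Unit (fun _ : Fin m => (1 : P))) l j =
        - ∑ j, L l j * y j := by
      simp [Matrix.mul_apply]
    rw [Matrix.add_apply, h3, hLy, Matrix.sub_apply]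
    simp only [AM, hL, Matrix.of_apply, Matrix.one_apply]
    by_cases hl : Odd (l : ℕ)
    · simp only [hl, if_true]
      by_cases hj : j ≤ l
      · have : (j : ℕ) < l + 1 := Nat.lt_succ_of_le hj
        simp [hj, this, sub_eq_add_neg]
      · have : ¬ (j : ℕ) < l + 1 := fun h => hj (Nat.le_of_lt_succ h)
        simp [hj, this]
    · simp only [hl, if_false]
      by_cases hj : l ≤ j
      · have : ¬ (j : ℕ) < l := fun h => by have : (l : ℕ) ≤ j := hj; omega
        simp [hj, this, sub_eq_add_neg]
      · have : (j : ℕ) < l := not_le.mp hj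
        simp [hj, this]
  rw [key, Matrix.det_mul, det_one_add_replicateCol_mul_replicateRow]
  have hdet : L.det = ∏ l ∈ Finset.range m, if Odd l then 1 - a l else 1 := by
    rw [det_of_isLowerTriangular]
    · rw [← Fin.prod_univ_eq_prod_range (fun l => if Odd l then 1 - a l else 1) m]
      refine Finset.prod_congr rfl fun l _ => ?_
      simp only [hL, Matrix.of_apply]
      split_ifs <;> simp_all [sub_eq_add_neg]
    · intro l j hlj
      have h : (l : ℕ) < j := hlj
      simp only [hL, Matrix.of_apply]
      have h1 : l ≠ j := fun e => by subst e; exact lt_irrefl _ h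
      have h2 : ¬ (j : ℕ) < l + 1 := by omega
      have h3 : ¬ (j : ℕ) < l := by omega
      simp [h1, h2, h3]
  rw [hdet]
  congr 1
  have := sum_tele Z m m le_rfl
  simp only [Fin.is_lt, if_true] at this
  simp only [dotProduct, one_mul, Finset.sum_neg_distrib, hy]
  rw [this, h0]; ring

open PowerSeries in
/-- `∏_{k<N} (1 - c q^k X)` -/
noncomputable def EN (q c : ℝ) (N : ℕ) : ℝ⟦X⟧ := ∏ k ∈ Finset.range N, (1 - C (c * q ^ k) * X)

open PowerSeries in
/-- letter weights -/
noncomputable def wl (t q : ℝ) (l : ℕ) : ℝ := if Odd l then t * q ^ (l / 2) else q ^ (l / 2)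

open PowerSeries in
/-- auxiliary sequence -/
noncomputable def zetaS (t q : ℝ) : ℕ → ℝ⟦X⟧
  | 0 => 1
  | k + 1 => ((1 - C (q ^ k) * X) * zetaS t q k - C (t * q ^ k) * X) * (1 - C (t * q ^ k) * X)⁻¹

open PowerSeries in
lemma one_sub_inv (c : ℝ) : (1 - C c * X : ℝ⟦X⟧) * (1 - C c * X)⁻¹ = 1 := by
  apply PowerSeries.mul_inv_cancel
  simp

open PowerSeries in
lemma zetaS_eq (t q : ℝ) (N : ℕ) :
    C (1 - t) * (EN q t N * zetaS t q N) = EN q 1 N - C t * EN q t N := by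
  induction N with
  | zero => simp [EN, zetaS]
  | succ k ih =>
    have h := one_sub_inv (t * q ^ k)
    simp only [EN, Finset.prod_range_succ, zetaS, one_mul] at ih ⊢
    set I := (1 - C (t * q ^ k) * X : ℝ⟦X⟧)⁻¹
    set E1 := ∏ k ∈ Finset.range k, (1 - C (q ^ k) * X : ℝ⟦X⟧)
    set Et := ∏ k ∈ Finset.range k, (1 - C (t * q ^ k) * X : ℝ⟦X⟧)
    set zz := zetaS t q k
    simp only [map_sub, map_mul, map_one] at *
    linear_combination (1 - C t) * Et * ((1 - C (q ^ k) * X) * zz - C t * C (q ^ k) * X) * h + (1 - C (q ^ k) * X) * ih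

open PowerSeries in
lemma det_weak (t q : ℝ) (N : ℕ) :
    C (1 - t) * (1 - (X : ℝ⟦X⟧) • (AM (2 * N) (wl t q)).map (C : ℝ →+* ℝ⟦X⟧)).det =
      EN q 1 N - C t * EN q t N := by
  have e : (X : ℝ⟦X⟧) • (AM (2 * N) (wl t q)).map (C : ℝ →+* ℝ⟦X⟧) =
      AM (2 * N) (fun l => C (wl t q l) * X) := by
    ext1 l j
    simp only [AM, Matrix.smul_apply, Matrix.map_apply, Matrix.of_apply]
    split_ifs <;> simp [mul_comm]
  rw [e, det_AM (2 * N) _ (fun l => if Odd l then (1 - C (q ^ (l / 2)) * X) * zetaS t q (l / 2) else zetaS t q (l / 2))]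
  · have h2 : ¬ Odd (2 * N) := by simp
    simp only [h2, if_false]
    rw [Nat.mul_div_cancel_left _ (by norm_num), ← zetaS_eq]
    congr 2
    clear e h2
    induction N with
    | zero => simp [EN]
    | succ N ih =>
      rw [mul_add, mul_one, Finset.prod_range_succ, Finset.prod_range_succ, ih, EN, EN, Finset.prod_range_succ]
      have h1 : ¬ Odd (2 * N) := by simp
      have h2 : Odd (2 * N + 1) := by simp
      have h3 : (2 * N + 1) / 2 = N := by omega
      simp [h1, h2, wl, h3]
  · simp [zetaS]
  · intro l hl
    have h1 : Odd (l + 1) := by grind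
    have h2 : (l + 1) / 2 = l / 2 := by grind
    simp [h1, h2, hl, wl]
  · intro l hl
    obtain ⟨k, rfl⟩ := hl
    have h1 : Odd (2 * k + 1) := by simp
    have h2 : ¬ Odd (2 * k + 1 + 1) := by grind
    have h3 : (2 * k + 1) / 2 = k := by omega
    have h4 : (2 * k + 1 + 1) / 2 = k + 1 := by omega
    simp only [h1, h2, wl, h3, h4, if_true, if_false, zetaS]
    have h := one_sub_inv (t * q ^ k)
    linear_combination ((1 - C (q ^ k) * X) * zetaS t q k - C (t * q ^ k) * X) * h

end DetPart

section Averaging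
open Matrix

/-- `σ` is increasing on fibers of `c` -/
def incF {n m : ℕ} (c : Fin n → Fin m) (σ : Equiv.Perm (Fin n)) : Prop :=
  ∀ i j, i < j → c i = c j → σ i < σ j

/-- stabilizer -/
noncomputable def Yst {n m : ℕ} (c : Fin n → Fin m) : Finset (Equiv.Perm (Fin n)) := by
  classical exact univ.filter (fun y => c ∘ y = c)

lemma mem_Yst {n m : ℕ} (c : Fin n → Fin m) (y : Equiv.Perm (Fin n)) :
    y ∈ Yst c ↔ c ∘ y = c := by simp [Yst]

lemma Yst_pos {n m : ℕ} (c : Fin n → Fin m) : (0 : ℝ) < (Yst c).card := by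
  have : (1 : Equiv.Perm (Fin n)) ∈ Yst c := by rw [mem_Yst]; rfl
  exact_mod_cast Finset.card_pos.mpr ⟨_, this⟩

lemma exu_sort {n m : ℕ} (c : Fin n → Fin m) (hc : Antitone c) (σ : Equiv.Perm (Fin n)) :
    ∃! y : Equiv.Perm (Fin n), c ∘ y = c ∧ incF c (σ * y) := by
  set f : Fin n → (Fin m)ᵒᵈ ×ₗ Fin n := fun i => toLex (OrderDual.toDual (c i), σ i) with hf
  have finj : Function.Injective f := by
    intro i j h
    have := congrArg (fun x => (ofLex x).2) h
    exact σ.injective this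
  have hm := Tuple.monotone_sort f
  refine ⟨Tuple.sort f, ⟨?_, ?_⟩, ?_⟩
  · have h1 : Antitone (c ∘ Tuple.sort f) := by
      intro i j hij
      have := hm hij
      simp only [hf, Function.comp, Prod.Lex.toLex_le_toLex] at this
      rcases this with h | h
      · exact le_of_lt h
      · exact (OrderDual.toDual_inj.mp h.1).ge
    have := Tuple.unique_antitone (f := c) (σ := Tuple.sort f) (τ := 1) h1 (by simpa using hc)
    simpa using this
  · have h1 : Antitone (c ∘ Tuple.sort f) := by
      intro i j hij
      have := hm hij
      simp only [hf, Function.comp, Prod.Lex.toLex_le_toLex] at this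
      rcases this with h | h
      · exact le_of_lt h
      · exact (OrderDual.toDual_inj.mp h.1).ge
    have h2 := Tuple.unique_antitone (f := c) (σ := Tuple.sort f) (τ := 1) h1 (by simpa using hc)
    simp only [Equiv.Perm.coe_one, Function.comp_id] at h2
    intro i j hij hcij
    have h3 : c (Tuple.sort f i) = c (Tuple.sort f j) := by
      have a1 := congrFun h2 i
      have a2 := congrFun h2 j
      simp only [Function.comp] at a1 a2
      rw [a1, a2, hcij]
    have := hm hij.le
    simp only [hf, Function.comp, Prod.Lex.toLex_le_toLex] at this
    have h4 : σ (Tuple.sort f i) ≤ σ (Tuple.sort f j) := by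
      rcases this with h | h
      · have : c (Tuple.sort f j) < c (Tuple.sort f i) := h
        rw [h3] at this; exact absurd this (lt_irrefl _)
      · exact h.2
    refine lt_of_le_of_ne h4 fun e => ?_
    exact hij.ne ((Tuple.sort f).injective (σ.injective e))
  · rintro y ⟨hy1, hy2⟩
    have hmy : Monotone (f ∘ y) := by
      intro i j hij
      rcases hij.eq_or_lt with rfl | hlt
      · exact le_rfl
      simp only [hf, Function.comp, Prod.Lex.toLex_le_toLex]
      have a1 : c (y i) = c i := congrFun hy1 i
      have a2 : c (y j) = c j := congrFun hy1 j
      rcases (hc hij).eq_or_lt with h | h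
      · right
        exact ⟨by rw [a1, a2, h], (hy2 i j hlt h.symm).le⟩
      · left
        rw [a1, a2]; exact h
    have := Tuple.unique_monotone hmy hm
    ext i
    exact congrArg _ (finj (congrFun this i))

/-- weight -/
def Wt {n m : ℕ} (M : Matrix (Fin m) (Fin m) ℝ) (σ : Equiv.Perm (Fin n)) (c : Fin n → Fin m) : ℝ :=
  ∏ i, M (c i) (c (σ i))

lemma Wt_mul {n m : ℕ} (M : Matrix (Fin m) (Fin m) ℝ) (σ y : Equiv.Perm (Fin n)) (c : Fin n → Fin m)
    (hy : c ∘ y = c) : Wt M (σ * y) c = Wt M σ c := by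
  unfold Wt
  rw [← Equiv.prod_comp y (fun i => M (c i) (c (σ i)))]
  refine Finset.prod_congr rfl fun i _ => ?_
  have : c (y i) = c i := congrFun hy i
  simp [this]

open Classical in
lemma step2 {n m : ℕ} (M : Matrix (Fin m) (Fin m) ℝ) (c : Fin n → Fin m) (hc : Antitone c) :
    ∑ σ : Equiv.Perm (Fin n), Wt M σ c = (Yst c).card *
      ∑ σ : Equiv.Perm (Fin n), if incF c σ then Wt M σ c else 0 := by
  have h1 : ∀ σ : Equiv.Perm (Fin n), Wt M σ c =
      ∑ y ∈ Yst c, if incF c (σ * y) then Wt M (σ * y) c else 0 := by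
    intro σ
    obtain ⟨y, ⟨hy1, hy2⟩, hu⟩ := exu_sort c hc σ
    rw [Finset.sum_eq_single y]
    · rw [if_pos hy2, Wt_mul _ _ _ _ hy1]
    · intro b hb hne
      rw [if_neg]
      intro h
      exact hne (hu b ⟨(mem_Yst c b).1 hb, h⟩)
    · intro h; exact absurd ((mem_Yst c y).2 hy1) h
  rw [Finset.sum_congr rfl (fun σ _ => h1 σ), Finset.sum_comm, Finset.sum_congr rfl (g := fun _ => ∑ σ : Equiv.Perm (Fin n), if incF c σ then Wt M σ c else 0)]
  · rw [Finset.sum_const, nsmul_eq_mul]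
  · intro y _
    exact Equiv.sum_comp (Equiv.mulRight y) (fun σ => if incF c σ then Wt M σ c else 0)

lemma sum_Wt_comp {n m : ℕ} (M : Matrix (Fin m) (Fin m) ℝ) (c : Fin n → Fin m) (ρ : Equiv.Perm (Fin n)) :
    ∑ σ : Equiv.Perm (Fin n), Wt M σ (c ∘ ρ) = ∑ σ : Equiv.Perm (Fin n), Wt M σ c := by
  refine Fintype.sum_equiv (MulAut.conj ρ).toEquiv _ _ fun σ => ?_
  unfold Wt
  refine Fintype.prod_equiv ρ _ _ fun i => ?_
  simp

open Classical in
lemma exists_antitone_perm {n m : ℕ} (c : Fin n → Fin m) : ∃ ρ : Equiv.Perm (Fin n), Antitone (c ∘ ρ) := by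
  refine ⟨Tuple.sort (OrderDual.toDual ∘ c), ?_⟩
  exact Tuple.monotone_sort (OrderDual.toDual ∘ c)

open Classical in
lemma step1 {n m : ℕ} (G : (Fin n → Fin m) → ℝ) (hG : ∀ c (ρ : Equiv.Perm (Fin n)), G (c ∘ ρ) = G c) :
    ∑ c, G c = n.factorial * ∑ c, if Antitone c then G c / (Yst c).card else 0 := by
  have h1 : ∀ c, G c = ∑ ρ : Equiv.Perm (Fin n),
      if Antitone (c ∘ ρ) then G (c ∘ ρ) / (Yst (c ∘ ρ)).card else 0 := by
    intro c
    obtain ⟨ρ₀, h0⟩ := exists_antitone_perm c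
    rw [← Equiv.sum_comp (Equiv.mulLeft ρ₀)]
    have : ∀ y : Equiv.Perm (Fin n), (if Antitone (c ∘ ⇑((Equiv.mulLeft ρ₀) y)) then
        G (c ∘ ((Equiv.mulLeft ρ₀) y)) / (Yst (c ∘ ((Equiv.mulLeft ρ₀) y))).card else 0) =
        if y ∈ Yst (c ∘ ρ₀) then G c / (Yst (c ∘ ρ₀)).card else 0 := by
      intro y
      have e : c ∘ ((Equiv.mulLeft ρ₀) y) = (c ∘ ρ₀) ∘ y := rfl
      by_cases hy : y ∈ Yst (c ∘ ρ₀)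
      · have hy' := (mem_Yst _ _).1 hy
        rw [if_pos hy, e, hy', if_pos h0, hG]
      · rw [if_neg hy, if_neg]
        intro ha
        apply hy
        rw [mem_Yst]
        have := Tuple.unique_antitone (f := c) (σ := ρ₀ * y) (τ := ρ₀) ha h0
        exact this
    rw [Finset.sum_congr rfl (fun y _ => this y), Finset.sum_ite_mem, Finset.univ_inter,
      Finset.sum_const, nsmul_eq_mul, mul_div_cancel₀]
    exact (Yst_pos _).ne'
  rw [Finset.sum_congr rfl (fun c _ => h1 c), Finset.sum_comm, Finset.sum_congr rfl (g := fun _ => ∑ c, if Antitone c then G c / (Yst c).card else 0)]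
  · rw [Finset.sum_const, nsmul_eq_mul, Finset.card_univ, Fintype.card_perm, Fintype.card_fin]
  · intro ρ _
    exact Equiv.sum_comp (Equiv.arrowCongr ρ.symm (Equiv.refl _)) (fun c : Fin n → Fin m => if Antitone c then G c / (Yst c).card else 0)

open Classical in
lemma sn_sorted {n m : ℕ} (M : Matrix (Fin m) (Fin m) ℝ) :
    sn M n = ∑ c : Fin n → Fin m, ∑ σ : Equiv.Perm (Fin n),
      if Antitone c ∧ incF c σ then Wt M σ c else 0 := by
  have : SG n (fun _ => M) = ∑ c : Fin n → Fin m, ∑ σ : Equiv.Perm (Fin n), Wt M σ c := by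
    unfold SG; rw [Finset.sum_comm]; rfl
  rw [sn, this, step1 _ (sum_Wt_comp M), mul_div_cancel_left₀ _ (by exact_mod_cast n.factorial_ne_zero)]
  refine Finset.sum_congr rfl fun c _ => ?_
  by_cases hc : Antitone c
  · rw [if_pos hc, step2 M c hc, mul_div_cancel_left₀ _ (Yst_pos c).ne']
    simp [hc]
  · simp [hc]

end Averaging

section Insertion
open Matrix

lemma orbit_lt {n : ℕ} (σ : Equiv.Perm (Fin n)) (P : Fin n → Prop)
    (h : ∀ x, P x → x < σ x → P (σ x) ∧ σ x < σ (σ x)) (x : Fin n) (hP : P x) (hx : x < σ x) : False := by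
  have key : ∀ k : ℕ, ∀ x : Fin n, P x → x < σ x → n - (x : ℕ) ≤ k → False := by
    intro k
    induction k with
    | zero => intro x _ _ hk; have := x.2; omega
    | succ k ih =>
      intro x hP hx hk
      obtain ⟨h1, h2⟩ := h x hP hx
      refine ih (σ x) h1 h2 ?_
      have : (x : ℕ) < σ x := hx
      omega
  exact key _ x hP hx le_rfl

lemma orbit_gt {n : ℕ} (σ : Equiv.Perm (Fin n)) (P : Fin n → Prop)
    (h : ∀ x, P x → σ x < x → P (σ x) ∧ σ (σ x) < σ x) (x : Fin n) (hP : P x) (hx : σ x < x) : False := by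
  have key : ∀ k : ℕ, ∀ x : Fin n, P x → σ x < x → (x : ℕ) ≤ k → False := by
    intro k
    induction k with
    | zero => intro x _ h hk; have : (σ x : ℕ) < x := h; omega
    | succ k ih =>
      intro x hP hx hk
      obtain ⟨h1, h2⟩ := h x hP hx
      refine ih (σ x) h1 h2 ?_
      have : (σ x : ℕ) < x := hx
      omega
  exact key _ x hP hx le_rfl

/-- valid pairs, odd letters `< j` may carry fixed points -/
def VW {n m : ℕ} (j : ℕ) (c : Fin n → Fin m) (σ : Equiv.Perm (Fin n)) : Prop :=
  Antitone c ∧ incF c σ ∧ ∀ i, (Odd (c i : ℕ) → i ≤ σ i ∧ (σ i = i → (c i : ℕ) < j)) ∧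
    (¬ Odd (c i : ℕ) → σ i ≤ i)

open Classical in
/-- weighted sum over valid pairs -/
noncomputable def WS (w : ℕ → ℝ) (m j n : ℕ) : ℝ :=
  ∑ c : Fin n → Fin m, ∑ σ : Equiv.Perm (Fin n), if VW j c σ then ∏ i, w (c i) else 0

lemma Wt_AM {n m : ℕ} (w : ℕ → ℝ) (c : Fin n → Fin m) (σ : Equiv.Perm (Fin n)) (hc : Antitone c)
    (_hi : incF c σ) (h : VW m c σ) : Wt (AM m w) σ c = ∏ i, w (c i) := by
  unfold Wt
  refine Finset.prod_congr rfl fun i _ => ?_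
  obtain ⟨h1, h2⟩ := h.2.2 i
  simp only [AM, Matrix.of_apply]
  by_cases ho : Odd (c i : ℕ)
  · rw [if_pos ho, if_pos (hc (h1 ho).1)]
  · rw [if_neg ho, if_pos (hc (h2 ho))]

lemma Wt_AM0 {n m : ℕ} (w : ℕ → ℝ) (c : Fin n → Fin m) (σ : Equiv.Perm (Fin n)) (hc : Antitone c)
    (hi : incF c σ) (h : ¬ VW m c σ) : Wt (AM m w) σ c = 0 := by
  by_contra hne
  apply h
  have hall : ∀ i, AM m w (c i) (c (σ i)) ≠ 0 := by
    intro i h0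
    exact hne (Finset.prod_eq_zero (Finset.mem_univ i) h0)
  have hodd : ∀ i, Odd (c i : ℕ) → c (σ i) ≤ c i := by
    intro i ho
    have := hall i
    simp only [AM, Matrix.of_apply, if_pos ho] at this
    by_contra hh
    exact this (if_neg hh)
  have heven : ∀ i, ¬ Odd (c i : ℕ) → c i ≤ c (σ i) := by
    intro i ho
    have := hall i
    simp only [AM, Matrix.of_apply, if_neg ho] at this
    by_contra hh
    exact this (if_neg hh)
  refine ⟨hc, hi, fun i => ⟨fun ho => ⟨?_, fun _ => (c i).2⟩, fun ho => ?_⟩⟩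
  · by_contra hlt
    refine orbit_gt σ (fun x => Odd (c x : ℕ)) ?_ i ho (not_le.mp hlt)
    intro x hx hxs
    have e : c (σ x) = c x := le_antisymm (hodd x hx) (hc hxs.le)
    exact ⟨by simpa only [e] using hx, hi _ _ hxs e⟩
  · by_contra hlt
    refine orbit_lt σ (fun x => ¬ Odd (c x : ℕ)) ?_ i ho (not_le.mp hlt)
    intro x hx hxs
    have e : c x = c (σ x) := le_antisymm (heven x hx) (hc hxs.le)
    exact ⟨by simpa only [← e] using hx, hi _ _ hxs e⟩

lemma sn_eq_WS {n m : ℕ} (w : ℕ → ℝ) : sn (AM m w) n = WS w m m n := by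
  classical
  rw [sn_sorted, WS]
  refine Finset.sum_congr rfl fun c _ => Finset.sum_congr rfl fun σ _ => ?_
  by_cases h : Antitone c ∧ incF c σ
  · rw [if_pos h]
    by_cases hv : VW m c σ
    · rw [if_pos hv, Wt_AM w c σ h.1 h.2 hv]
    · rw [if_neg hv, Wt_AM0 w c σ h.1 h.2 hv]
  · rw [if_neg h, if_neg]
    intro hv; exact h ⟨hv.1, hv.2.1⟩

/-- insert a fixed point -/
def insP {n : ℕ} (p : Fin (n + 1)) (σ : Equiv.Perm (Fin n)) : Equiv.Perm (Fin (n + 1)) :=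
  (finSuccEquiv' p).permCongr.symm (Equiv.optionCongr σ)

lemma insP_self {n : ℕ} (p : Fin (n + 1)) (σ : Equiv.Perm (Fin n)) : insP p σ p = p := by
  simp [insP, Equiv.permCongr_apply]

lemma insP_succAbove {n : ℕ} (p : Fin (n + 1)) (σ : Equiv.Perm (Fin n)) (i : Fin n) :
    insP p σ (p.succAbove i) = p.succAbove (σ i) := by
  simp [insP, Equiv.permCongr_apply]

lemma sum_insP {n : ℕ} (p : Fin (n + 1)) (g : Equiv.Perm (Fin (n + 1)) → ℝ) :
    ∑ σ : Equiv.Perm (Fin (n + 1)), (if σ p = p then g σ else 0) = ∑ σ : Equiv.Perm (Fin n), g (insP p σ) := by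
  rw [← Equiv.sum_comp ((finSuccEquiv' p).permCongr.symm), ← Equiv.sum_comp Equiv.Perm.decomposeOption.symm,
    Fintype.sum_prod_type, Fintype.sum_option]
  rw [add_eq_left.mpr]
  · refine Finset.sum_congr rfl fun σ _ => ?_
    have : (finSuccEquiv' p).permCongr.symm (Equiv.Perm.decomposeOption.symm (none, σ)) = insP p σ := by
      ext x
      simp [insP, Equiv.Perm.decomposeOption_symm_apply]
    rw [this, if_pos (insP_self p σ)]
  · refine Finset.sum_eq_zero fun i _ => Finset.sum_eq_zero fun σ _ => ?_
    rw [if_neg]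
    simp [Equiv.permCongr_apply, Equiv.Perm.decomposeOption_symm_apply]

@[elab_as_elim]
lemma fin_ind {n : ℕ} (p : Fin (n + 1)) {P : Fin (n + 1) → Prop} (h0 : P p)
    (h1 : ∀ i, P (p.succAbove i)) (x : Fin (n + 1)) : P x := by
  rcases Fin.eq_self_or_eq_succAbove p x with rfl | ⟨i, rfl⟩
  · exact h0
  · exact h1 i

lemma VW_ins {n m : ℕ} (j : Fin m) (hj : Odd (j : ℕ)) (p : Fin (n + 1)) (c : Fin n → Fin m)
    (σ : Equiv.Perm (Fin n)) :
    (VW (j + 1) (p.insertNth j c : Fin (n + 1) → Fin m) (insP p σ) ∧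
      ∀ i, i < p → (p.insertNth j c : Fin (n + 1) → Fin m) i ≠ j) ↔
    (VW (j + 1) c σ ∧ ∀ i : Fin n, j < c i ↔ i.castSucc < p) := by
  have sm : StrictMono p.succAbove := Fin.strictMono_succAbove p
  constructor
  · rintro ⟨⟨ha, hi, hv⟩, hf⟩
    refine ⟨⟨?_, ?_, ?_⟩, ?_⟩
    · intro a b hab
      have := ha (sm.monotone hab)
      simpa using this
    · intro a b hab hc
      have := hi _ _ (sm hab) (by simpa using hc)
      rw [insP_succAbove, insP_succAbove] at this
      exact sm.lt_iff_lt.mp this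
    · intro i
      have := hv (p.succAbove i)
      simp only [Fin.insertNth_apply_succAbove, insP_succAbove, sm.le_iff_le, sm.injective.eq_iff] at this
      exact this
    · intro i
      constructor
      · intro h
        by_contra hcon
        have hle : p ≤ i.castSucc := not_lt.mp hcon
        have h2 : p ≤ p.succAbove i := by
          rw [Fin.succAbove_of_le_castSucc _ _ hle]; exact hle.trans (Fin.castSucc_lt_succ).le
        have := ha h2
        simp at this
        exact absurd h (not_lt.mpr this)
      · intro h
        have h2 : p.succAbove i < p := by
          rw [Fin.succAbove_of_castSucc_lt _ _ h]; exact h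
        have h3 := ha h2.le
        have h4 := hf _ h2
        simp at h3 h4
        exact lt_of_le_of_ne h3 (Ne.symm h4)
  · rintro ⟨⟨ha, hi, hv⟩, hp⟩
    have lt_iff : ∀ i, p.succAbove i < p ↔ j < c i := by
      intro i
      rw [hp]
      constructor
      · intro h
        by_contra hc
        rw [Fin.succAbove_of_le_castSucc _ _ (not_lt.mp hc)] at h
        exact absurd h (not_lt.mpr ((not_lt.mp hc).trans (Fin.castSucc_lt_succ).le))
      · intro h; rw [Fin.succAbove_of_castSucc_lt _ _ h]; exact h
    have ne_p : ∀ i, p.succAbove i ≠ p := fun i => Fin.succAbove_ne p i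
    refine ⟨⟨?_, ?_, ?_⟩, ?_⟩
    · intro a b
      refine fin_ind p ?_ ?_ a <;> refine fin_ind p ?_ ?_ b
      · simp
      · intro i h
        have : ¬ p.succAbove i < p := not_lt.mpr h
        rw [lt_iff] at this
        simpa using this
      · intro i h
        have : p.succAbove i < p := lt_of_le_of_ne h (ne_p i)
        rw [lt_iff] at this
        simpa using this.le
      · intro i i' h
        simpa using ha (sm.le_iff_le.mp h)
    · intro a b
      refine fin_ind p ?_ ?_ a <;> refine fin_ind p ?_ ?_ b
      · intro h; exact absurd h (lt_irrefl _)
      · intro i h hc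
        simp at hc
        have h2 := ((hv i).1 (by rw [← hc]; exact hj)).1
        rw [insP_self, insP_succAbove]
        exact lt_of_lt_of_le h (sm.monotone h2)
      · intro i h hc
        rw [lt_iff] at h
        simp at hc
        rw [hc] at h
        exact absurd h (lt_irrefl _)
      · intro i i' h hc
        rw [insP_succAbove, insP_succAbove]
        exact sm (hi _ _ (sm.lt_iff_lt.mp h) (by simpa using hc))
    · intro x
      refine fin_ind p ?_ ?_ x
      · simp [insP_self]
      · intro i
        simp only [Fin.insertNth_apply_succAbove, insP_succAbove, sm.le_iff_le, sm.injective.eq_iff]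
        exact hv i
    · intro x
      refine fin_ind p ?_ ?_ x
      · intro h; exact absurd h (lt_irrefl _)
      · intro i h
        rw [lt_iff] at h
        simp only [Fin.insertNth_apply_succAbove]
        exact h.ne'

lemma exu_p {n m : ℕ} (j : Fin m) (c : Fin n → Fin m) (hc : Antitone c) :
    ∃! p : Fin (n + 1), ∀ i : Fin n, j < c i ↔ i.castSucc < p := by
  set k := (univ.filter (fun i => j < c i)).card with hk
  have hkn : k ≤ n := by
    calc k ≤ (univ : Finset (Fin n)).card := Finset.card_filter_le _ _
      _ = n := by simp
  have hkey : ∀ i : Fin n, (i : ℕ) < k ↔ j < c i := by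
    intro i
    exact Tuple.lt_card_gt_iff_apply_gt_of_antitone hc
  refine ⟨⟨k, by omega⟩, fun i => ?_, ?_⟩
  · rw [← hkey i, Fin.lt_def]; rfl
  · intro p hp
    ext
    simp only
    have h1 : ∀ i : Fin n, (i : ℕ) < k ↔ (i : ℕ) < p := by
      intro i; rw [hkey, hp, Fin.lt_def]; rfl
    have hp2 := p.2
    by_contra hne
    rcases lt_or_gt_of_ne hne with h | h
    · have := h1 ⟨p, by omega⟩
      simp at this; omega
    · have := h1 ⟨k, by omega⟩
      simp at this; omega

lemma VW_split {n m : ℕ} (j : Fin m) (hj : Odd (j : ℕ)) (c : Fin n → Fin m)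
    (σ : Equiv.Perm (Fin n)) (hV : VW (j + 1) c σ) (hn : ¬ VW j c σ) :
    ∃! p, σ p = p ∧ c p = j ∧ ∀ i, i < p → c i ≠ j := by
  classical
  obtain ⟨ha, hi, hv⟩ := hV
  have hex : ∃ i0, σ i0 = i0 ∧ c i0 = j := by
    by_contra hcon
    push Not at hcon
    apply hn
    refine ⟨ha, hi, fun i => ⟨fun ho => ⟨((hv i).1 ho).1, fun hs => ?_⟩, (hv i).2⟩⟩
    have h1 := ((hv i).1 ho).2 hs
    have h2 : (c i : ℕ) ≠ j := fun h => hcon i hs (Fin.ext h)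
    omega
  obtain ⟨i0, hi0, hci0⟩ := hex
  have hne : (univ.filter (fun i => c i = j)).Nonempty := ⟨i0, by simp [hci0]⟩
  set p := (univ.filter (fun i => c i = j)).min' hne with hp
  have hpm : c p = j := by
    have := Finset.min'_mem _ hne
    simpa using this
  have hpmin : ∀ i, c i = j → p ≤ i := fun i h => Finset.min'_le _ _ (by simp [h])
  refine ⟨p, ⟨?_, hpm, fun i hip h => absurd (hpmin i h) (not_le.mpr hip)⟩, ?_⟩
  · have h1 := ((hv p).1 (by rw [hpm]; exact hj)).1
    by_contra hne
    have hlt : p < σ p := lt_of_le_of_ne h1 (Ne.symm hne)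
    refine orbit_lt σ (fun x => c x = j ∧ x < i0) ?_ p ⟨hpm, ?_⟩ hlt
    · rintro x ⟨hx1, hx2⟩ hxs
      have h3 : σ x < i0 := by
        have := hi x i0 hx2 (by rw [hx1, hci0])
        rwa [hi0] at this
      have h4 : c (σ x) = j := by
        apply le_antisymm
        · rw [← hx1]; exact ha hxs.le
        · rw [← hci0]; exact ha h3.le
      exact ⟨⟨h4, h3⟩, hi _ _ hxs (by rw [hx1, h4])⟩
    · refine lt_of_le_of_ne (hpmin i0 hci0) ?_
      intro e
      rw [e] at hne
      exact hne hi0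
  · rintro p' ⟨_, h2, h3⟩
    apply le_antisymm
    · by_contra h
      exact h3 p (not_le.mp h) hpm
    · exact hpmin p' h2

lemma VW_mono {n m : ℕ} (j : ℕ) (c : Fin n → Fin m)
    (σ : Equiv.Perm (Fin n)) (hV : VW j c σ) : VW (j + 1) c σ :=
  ⟨hV.1, hV.2.1, fun i => ⟨fun ho => ⟨((hV.2.2 i).1 ho).1, fun h => by
    have := ((hV.2.2 i).1 ho).2 h; omega⟩, (hV.2.2 i).2⟩⟩

lemma not_VW {n m : ℕ} (j : Fin m) (hj : Odd (j : ℕ)) (c : Fin n → Fin m)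
    (σ : Equiv.Perm (Fin n)) (p : Fin n) (h1 : σ p = p) (h2 : c p = j) : ¬ VW j c σ := by
  intro h
  have := ((h.2.2 p).1 (by rw [h2]; exact hj)).2 h1
  rw [h2] at this
  exact lt_irrefl _ this

open Classical in
lemma WS_odd (w : ℕ → ℝ) (m n : ℕ) (j : Fin m) (hj : Odd (j : ℕ)) :
    WS w m (j + 1) (n + 1) = WS w m j (n + 1) + w j * WS w m (j + 1) n := by
  have h1 : ∀ (c : Fin (n + 1) → Fin m) (σ : Equiv.Perm (Fin (n + 1))),
      (if VW (j + 1) c σ then ∏ i, w (c i) else 0) = (if VW j c σ then ∏ i, w (c i) else 0) +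
        ∑ p, if σ p = p then (if c p = j then
          (if VW (j + 1) c σ ∧ ∀ i, i < p → c i ≠ j then ∏ i, w (c i) else 0) else 0) else 0 := by
    intro c σ
    by_cases hV : VW (j + 1) c σ
    · by_cases hV' : VW j c σ
      · rw [if_pos hV, if_pos hV', Finset.sum_eq_zero, add_zero]
        intro p _
        by_cases h1 : σ p = p
        · rw [if_pos h1, if_neg]
          intro h2; exact not_VW j hj c σ p h1 h2 hV'
        · rw [if_neg h1]
      · obtain ⟨p, ⟨hp1, hp2, hp3⟩, hu⟩ := VW_split j hj c σ hV hV'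
        rw [if_pos hV, if_neg hV', zero_add, Finset.sum_eq_single p]
        · rw [if_pos hp1, if_pos hp2, if_pos ⟨hV, hp3⟩]
        · intro b _ hb
          by_cases h1 : σ b = b
          · rw [if_pos h1]
            by_cases h2 : c b = j
            · rw [if_pos h2, if_neg]
              rintro ⟨_, h3⟩
              exact hb (hu b ⟨h1, h2, h3⟩)
            · rw [if_neg h2]
          · rw [if_neg h1]
        · simp
    · have hV' : ¬ VW j c σ := fun h => hV (VW_mono _ _ _ h)
      simp [hV, hV']
  unfold WS
  simp only [h1, Finset.sum_add_distrib]
  congr 1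
  have h2 : ∀ (p : Fin (n + 1)), ∑ c : Fin (n + 1) → Fin m, ∑ σ : Equiv.Perm (Fin (n + 1)),
      (if σ p = p then (if c p = j then
          (if VW (j + 1) c σ ∧ ∀ i, i < p → c i ≠ j then ∏ i, w (c i) else 0) else 0) else 0) =
      ∑ c : Fin n → Fin m, ∑ σ : Equiv.Perm (Fin n),
        if VW (j + 1) c σ ∧ ∀ i : Fin n, j < c i ↔ i.castSucc < p then w j * ∏ i, w (c i) else 0 := by
    intro p
    simp only [sum_insP p]
    rw [← Equiv.sum_comp (Fin.insertNthEquiv (fun _ => Fin m) p), Fintype.sum_prod_type, Finset.sum_eq_single j]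
    · refine Finset.sum_congr rfl fun c _ => Finset.sum_congr rfl fun σ _ => ?_
      have e : (Fin.insertNthEquiv (fun _ => Fin m) p) (j, c) = p.insertNth j c := rfl
      rw [e]
      simp only [VW_ins j hj p c σ]
      rw [if_pos (by simp), Fin.prod_univ_succAbove _ p]
      simp
    · intro b _ hb
      refine Finset.sum_eq_zero fun c _ => Finset.sum_eq_zero fun σ _ => ?_
      rw [if_neg]
      simpa using hb
    · simp
  calc ∑ c : Fin (n + 1) → Fin m, ∑ σ : Equiv.Perm (Fin (n + 1)), ∑ p : Fin (n + 1),
      (if σ p = p then (if c p = j then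
          (if VW (j + 1) c σ ∧ ∀ i, i < p → c i ≠ j then ∏ i, w (c i) else 0) else 0) else 0)
     = ∑ p : Fin (n + 1), ∑ c : Fin (n + 1) → Fin m, ∑ σ : Equiv.Perm (Fin (n + 1)),
      (if σ p = p then (if c p = j then
          (if VW (j + 1) c σ ∧ ∀ i, i < p → c i ≠ j then ∏ i, w (c i) else 0) else 0) else 0) := by
        rw [Finset.sum_comm (s := (univ : Finset (Fin (n + 1))))]
        refine Finset.sum_congr rfl fun c _ => ?_
        rw [Finset.sum_comm]
    _ = ∑ c : Fin n → Fin m, ∑ σ : Equiv.Perm (Fin n), ∑ p : Fin (n + 1),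
        if VW (j + 1) c σ ∧ ∀ i : Fin n, j < c i ↔ i.castSucc < p then w j * ∏ i, w (c i) else 0 := by
        simp only [h2]
        rw [Finset.sum_comm]
        refine Finset.sum_congr rfl fun c _ => ?_
        rw [Finset.sum_comm]
    _ = _ := by
        rw [Finset.mul_sum]
        refine Finset.sum_congr rfl fun c _ => ?_
        rw [Finset.mul_sum]
        refine Finset.sum_congr rfl fun σ _ => ?_
        by_cases hV : VW (j + 1) c σ
        · obtain ⟨p, hp, hu⟩ := exu_p j c hV.1
          rw [Finset.sum_eq_single p]
          · rw [if_pos ⟨hV, hp⟩, if_pos hV]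
          · intro b _ hb
            rw [if_neg]
            rintro ⟨_, h⟩
            exact hb (hu b h)
          · simp
        · simp [hV]

lemma WS_even (w : ℕ → ℝ) (m n j : ℕ) (hj : ¬ Odd j) :
    WS w m (j + 1) n = WS w m j n := by
  classical
  unfold WS
  refine Finset.sum_congr rfl fun c _ => Finset.sum_congr rfl fun σ _ => ?_
  have : VW (j + 1) c σ ↔ VW j c σ := by
    refine ⟨fun h => ⟨h.1, h.2.1, fun i => ⟨fun ho => ⟨((h.2.2 i).1 ho).1, fun hs => ?_⟩, (h.2.2 i).2⟩⟩, VW_mono _ _ _⟩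
    have h1 := ((h.2.2 i).1 ho).2 hs
    have : (c i : ℕ) ≠ j := fun e => hj (e ▸ ho)
    omega
  simp only [this]

lemma WS_zero (w : ℕ → ℝ) (m j : ℕ) : WS w m j 0 = 1 := by
  classical
  unfold WS
  have : ∀ (c : Fin 0 → Fin m) (σ : Equiv.Perm (Fin 0)), VW j c σ := fun c σ =>
    ⟨fun i => i.elim0, fun i => i.elim0, fun i => i.elim0⟩
  simp [this]

open PowerSeries in
lemma WS_gf (t q : ℝ) (N : ℕ) : ∀ k ≤ N,
    PowerSeries.mk (WS (wl t q) (2 * N) (2 * k)) * EN q t k = PowerSeries.mk (WS (wl t q) (2 * N) 0) := by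
  intro k
  induction k with
  | zero => intro _; simp [EN]
  | succ k ih =>
    intro hk
    rw [← ih (by omega), EN, Finset.prod_range_succ, ← EN, mul_comm (EN q t k), ← mul_assoc]
    congr 1
    have hodd : Odd (2 * k + 1) := by simp
    have hrec := fun n => WS_odd (wl t q) (2 * N) n ⟨2 * k + 1, by omega⟩ hodd
    simp only [] at hrec
    have hw : wl t q (2 * k + 1) = t * q ^ k := by
      have : (2 * k + 1) / 2 = k := by omega
      simp [wl, this]
    rw [hw] at hrec
    have hev := fun n => WS_even (wl t q) (2 * N) n (2 * k) (by simp)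
    ext n
    rw [show 2 * (k + 1) = 2 * k + 1 + 1 by ring]
    cases n with
    | zero => simp [WS_zero, ← mul_assoc, mul_sub]
    | succ n =>
      rw [mul_sub, mul_one, mul_comm (C _) X, ← mul_assoc, map_sub, coeff_mk, coeff_mk, coeff_mul_C,
        coeff_succ_mul_X, coeff_mk, hrec, hev]
      ring

lemma strict_gf (t q : ℝ) (N : ℕ) :
    PowerSeries.mk (WS (wl t q) (2 * N) 0) * (EN q 1 N - PowerSeries.C t * EN q t N) =
      PowerSeries.C (1 - t) * EN q t N := by
  have h1 := WS_gf t q N N le_rfl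
  have h2 := det_weak t q N
  have h3 := mmt (AM (2 * N) (wl t q))
  have h4 : PowerSeries.mk (sn (AM (2 * N) (wl t q))) = PowerSeries.mk (WS (wl t q) (2 * N) (2 * N)) := by
    congr 1; funext n; exact sn_eq_WS _
  rw [h4] at h3
  rw [← h1, ← h2]
  linear_combination (PowerSeries.C (1 - t) * EN q t N) * h3

end Insertion

section PPart

/-- q-counting of chains -/
noncomputable def Pq (q : ℝ) : ℕ → ℕ → ℝ
  | 0, _ => 1
  | n + 1, M => ∑ w ∈ range M, q ^ w * Pq q n (w + 1)

lemma Pq_succ_zero (q : ℝ) (n : ℕ) : Pq q (n + 1) 0 = 0 := by simp [Pq]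

lemma Pq_succ_succ (q : ℝ) (n M : ℕ) :
    Pq q (n + 1) (M + 1) = Pq q (n + 1) M + q ^ M * Pq q n (M + 1) := by
  simp [Pq, Finset.sum_range_succ]

lemma Pq_closed (q : ℝ) (n : ℕ) : ∀ M, Pq q n M * ∏ i ∈ range n, (1 - q ^ (i + 1)) =
    ∏ i ∈ range n, (1 - q ^ (M + i)) := by
  induction n with
  | zero => intro M; simp [Pq]
  | succ n ih =>
    intro M
    induction M with
    | zero => rw [Pq_succ_zero, zero_mul, Finset.prod_range_succ' (fun i => 1 - q ^ (0 + i))]; simp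
    | succ M ihM =>
      have h1 := ih (M + 1)
      rw [Pq_succ_succ, add_mul, ihM, Finset.prod_range_succ (fun i => 1 - q ^ (i + 1)), Finset.prod_range_succ' (fun i => 1 - q ^ (M + i)),
        Finset.prod_range_succ (fun i => 1 - q ^ (M + 1 + i))]
      have h2 : ∏ k ∈ range n, (1 - q ^ (M + (k + 1))) = ∏ i ∈ range n, (1 - q ^ (M + 1 + i)) := by
        refine Finset.prod_congr rfl fun i _ => ?_
        ring_nf
      rw [h2, ← h1]
      ring

open PowerSeries in
lemma Pq_gf (q t : ℝ) (N : ℕ) : PowerSeries.mk (fun n => t ^ n * Pq q n N) * EN q t N = 1 := by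
  induction N with
  | zero =>
    have : PowerSeries.mk (fun n => t ^ n * Pq q n 0) = 1 := by
      ext n
      cases n with
      | zero => simp [Pq]
      | succ n => simp [Pq_succ_zero, PowerSeries.coeff_one]
    rw [this]; simp [EN]
  | succ N ih =>
    rw [EN, Finset.prod_range_succ, ← EN, mul_comm (EN q t N), ← mul_assoc]
    refine Eq.trans ?_ ih
    congr 1
    ext n
    cases n with
    | zero => simp [Pq, ← mul_assoc, mul_sub]
    | succ n =>
      rw [mul_sub, mul_one, mul_comm (C _) X, ← mul_assoc, map_sub, coeff_mk, coeff_mk, coeff_mul_C,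
        coeff_succ_mul_X, coeff_mk, Pq_succ_succ]
      ring

open Classical in
/-- chain sums -/
noncomputable def RR (q : ℝ) (K n u : ℕ) (D : ℕ → Prop) : ℝ :=
  ∑ b : Fin n → Fin K, if (∀ i, (b i : ℕ) < u) ∧ ∀ i j, i < j → (b j : ℕ) + (if D i then 1 else 0) ≤ b i then
    ∏ i, q ^ (b i : ℕ) else 0

open Classical in
lemma RR_succ (q : ℝ) (K n u : ℕ) (hu : u ≤ K) (D : ℕ → Prop) : RR q K (n + 1) u D =
    ∑ v ∈ range u, q ^ v * RR q K n (v + 1 - if D 0 then 1 else 0) (fun i => D (i + 1)) := by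
  have e1 : ∑ v ∈ range u, q ^ v * RR q K n (v + 1 - if D 0 then 1 else 0) (fun i => D (i + 1)) =
      ∑ v : Fin K, if (v : ℕ) < u then q ^ (v : ℕ) * RR q K n (v + 1 - if D 0 then 1 else 0) (fun i => D (i + 1)) else 0 := by
    rw [Fin.sum_univ_eq_sum_range (fun v => if v < u then q ^ v * RR q K n (v + 1 - if D 0 then 1 else 0) (fun i => D (i + 1)) else 0) K,
      ← Finset.sum_filter]
    congr 1
    ext v; simp; omega
  rw [e1, RR, ← Equiv.sum_comp (Fin.consEquiv (fun _ => Fin K)), Fintype.sum_prod_type]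
  refine Finset.sum_congr rfl fun v _ => ?_
  have key : ∀ b : Fin n → Fin K, ((∀ i, ((Fin.cons v b : Fin (n + 1) → Fin K) i : ℕ) < u) ∧ ∀ i j : Fin (n + 1), i < j →
      ((Fin.cons v b : Fin (n + 1) → Fin K) j : ℕ) + (if D i then 1 else 0) ≤ (Fin.cons v b : Fin (n + 1) → Fin K) i) ↔
      (v : ℕ) < u ∧ ((∀ i, (b i : ℕ) < v + 1 - if D 0 then 1 else 0) ∧
        ∀ i j, i < j → (b j : ℕ) + (if D (i + 1) then 1 else 0) ≤ b i) := by
    intro b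
    constructor
    · rintro ⟨h1, h2⟩
      refine ⟨h1 0, fun i => ?_, fun i j hij => ?_⟩
      · have := h2 0 i.succ (Fin.succ_pos i)
        by_cases hD : D 0 <;> simp [hD] at this ⊢ <;> omega
      · have := h2 i.succ j.succ (Fin.succ_lt_succ_iff.mpr hij)
        simpa using this
    · rintro ⟨h1, h2, h3⟩
      refine ⟨fun i => ?_, fun i j hij => ?_⟩
      · refine Fin.cases ?_ (fun i => ?_) i
        · simpa using h1
        · have := h2 i
          simp only [Fin.cons_succ]
          omega
      · revert hij
        refine Fin.cases ?_ (fun i => ?_) i <;> refine Fin.cases ?_ (fun j => ?_) j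
        · intro h; exact absurd h (lt_irrefl _)
        · intro _
          have := h2 j
          by_cases hD : D 0 <;> simp [hD] at this ⊢ <;> omega
        · intro h; exact absurd h (Fin.not_lt_zero _)
        · intro h
          simpa using h3 i j (Fin.succ_lt_succ_iff.mp h)
  have e2 : ∀ b : Fin n → Fin K, (Fin.consEquiv (fun _ => Fin K)) (v, b) = (Fin.cons v b : Fin (n + 1) → Fin K) := fun b => rfl
  simp only [e2, key]
  by_cases hv : (v : ℕ) < u
  · simp only [hv, true_and, if_true]
    rw [RR, Finset.mul_sum]
    refine Finset.sum_congr rfl fun b _ => ?_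
    rw [Fin.prod_univ_succ]
    simp
  · simp [hv]

open Classical in
lemma RR_eq (q : ℝ) (K n : ℕ) : ∀ (u : ℕ) (_ : u ≤ K) (D : ℕ → Prop), RR q K n u D =
    q ^ (∑ i ∈ range (n - 1), if D i then (i + 1) else 0) *
      Pq q n (u - ∑ i ∈ range (n - 1), if D i then 1 else 0) := by
  induction n with
  | zero => intro u hu D; simp [RR, Pq]
  | succ n ih =>
    intro u hu D
    rw [RR_succ q K n u hu]
    have h1 : ∀ v ∈ range u, q ^ v * RR q K n (v + 1 - if D 0 then 1 else 0) (fun i => D (i + 1)) =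
        q ^ v * (q ^ (∑ i ∈ range (n - 1), if D (i + 1) then (i + 1) else 0) *
      Pq q n ((v + 1 - if D 0 then 1 else 0) - ∑ i ∈ range (n - 1), if D (i + 1) then 1 else 0)) := by
      intro v hv
      rw [ih _ (by have := mem_range.1 hv; omega)]
    rw [Finset.sum_congr rfl h1]
    cases n with
    | zero => simp [Pq]
    | succ n =>
      simp only [Nat.add_sub_cancel]
      rw [Finset.sum_range_succ' (fun i => if D i then (i + 1) else 0), Finset.sum_range_succ' (fun i => if D i then 1 else 0)]
      simp only [zero_add]
      set x := if D 0 then 1 else 0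
      set d := ∑ i ∈ range n, if D (i + 1) then 1 else 0 with hd
      have e1 : (∑ i ∈ range n, if D (i + 1) then (i + 1 + 1) else 0) =
          (∑ i ∈ range n, if D (i + 1) then (i + 1) else 0) + d := by
        rw [hd, ← Finset.sum_add_distrib]
        refine Finset.sum_congr rfl fun i _ => ?_
        split_ifs <;> rfl
      rw [e1]
      set s := ∑ i ∈ range n, if D (i + 1) then (i + 1) else 0
      have e2 : ∀ u : ℕ, ∑ v ∈ range u, q ^ v * Pq q (n + 1) (v + 1 - x - d) = q ^ (d + x) * Pq q (n + 1 + 1) (u - (d + x)) := by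
        intro u
        induction u with
        | zero => simp [Pq_succ_zero]
        | succ u ihu =>
          rw [Finset.sum_range_succ, ihu]
          by_cases hle : d + x ≤ u
          · obtain ⟨r, rfl⟩ := Nat.exists_eq_add_of_le hle
            have a1 : d + x + r - (d + x) = r := by omega
            have a2 : d + x + r + 1 - (d + x) = r + 1 := by omega
            have a3 : d + x + r + 1 - x - d = r + 1 := by omega
            rw [a1, a2, a3, Pq_succ_succ q (n + 1) r]
            ring
          · have a1 : u - (d + x) = 0 := by omega
            have a2 : u + 1 - (d + x) = 0 := by omega
            have a3 : u + 1 - x - d = 0 := by omega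
            rw [a1, a2, a3, Pq_succ_zero, Pq_succ_zero]
            ring
      calc _ = q ^ s * ∑ v ∈ range u, q ^ v * Pq q (n + 1) (v + 1 - x - d) := by
            rw [Finset.mul_sum]
            refine Finset.sum_congr rfl fun v _ => ?_
            ring
        _ = _ := by
          rw [e2]; ring

/-- the DEX set -/
def DEX {n : ℕ} (σ : Equiv.Perm (Fin n)) (i : ℕ) : Prop :=
  (¬ i < pf σ i ∧ i + 1 < pf σ (i + 1)) ∨ ((i < pf σ i ↔ i + 1 < pf σ (i + 1)) ∧ pf σ (i + 1) < pf σ i)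

lemma pf_ne {n : ℕ} (σ : Equiv.Perm (Fin n)) (i j : ℕ) (hi : i < n) (hj : j < n) (hij : i ≠ j) :
    pf σ i ≠ pf σ j := by
  simp only [pf, hi, hj, dif_pos]
  intro h
  have := σ.injective (Fin.ext h)
  simp at this
  exact hij this

lemma pf_lt {n : ℕ} (σ : Equiv.Perm (Fin n)) (i : ℕ) (hi : i < n) : pf σ i < n := by
  simp only [pf, hi, dif_pos]; exact (σ _).2

lemma pf_val {n : ℕ} (σ : Equiv.Perm (Fin n)) (i : Fin n) : pf σ i = σ i := by
  simp [pf]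

open Classical in
lemma DEX_sum {n : ℕ} (σ : Equiv.Perm (Fin n)) :
    (∑ i ∈ range (n - 1), if DEX σ i then (i + 1) else 0) = majN σ - excN σ := by
  rcases Nat.eq_zero_or_pos n with rfl | hn
  · simp [majN, excN]
  have key : ∀ m, m < n → (∑ i ∈ range m, if DEX σ i then (i + 1) else 0) +
      (∑ i ∈ range m, if i < pf σ i then 1 else 0) =
      (∑ i ∈ range m, if pf σ (i + 1) < pf σ i then (i + 1) else 0) + m * (if m < pf σ m then 1 else 0) := by
    intro m
    induction m with
    | zero => simp
    | succ m ih =>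
      intro hm
      have ih := ih (by omega)
      rw [Finset.sum_range_succ, Finset.sum_range_succ, Finset.sum_range_succ]
      have hne := pf_ne σ m (m + 1) (by omega) hm (by omega)
      have : (if DEX σ m then 1 else 0) + (if m < pf σ m then 1 else 0) =
          (if pf σ (m + 1) < pf σ m then 1 else 0) + (if m + 1 < pf σ (m + 1) then 1 else 0) := by
        unfold DEX
        by_cases h1 : m < pf σ m <;> by_cases h2 : m + 1 < pf σ (m + 1) <;>
          by_cases h3 : pf σ (m + 1) < pf σ m <;> simp [h1, h2, h3] <;> omega
      have c1 : (if DEX σ m then (m + 1) else 0) = (m + 1) * (if DEX σ m then 1 else 0) := by simp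
      have c2 : (if pf σ (m + 1) < pf σ m then (m + 1) else 0) = (m + 1) * (if pf σ (m + 1) < pf σ m then 1 else 0) := by simp
      rw [c1, c2]
      generalize (if DEX σ m then 1 else 0) = a at *
      generalize (if m < pf σ m then 1 else 0) = b at *
      generalize (if pf σ (m + 1) < pf σ m then 1 else 0) = c at *
      generalize (if m + 1 < pf σ (m + 1) then 1 else 0) = d at *
      nlinarith
  have h := key (n - 1) (by omega)
  have hlast : ¬ (n - 1 < pf σ (n - 1)) := by
    have := pf_lt σ (n - 1) (by omega); omega
  simp only [hlast, if_false, mul_zero, add_zero] at h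
  have h1 : majN σ = ∑ i ∈ range (n - 1), if pf σ (i + 1) < pf σ i then (i + 1) else 0 := by
    rw [majN, Finset.sum_filter]
  have h2 : excN σ = ∑ i ∈ range (n - 1), if i < pf σ i then 1 else 0 := by
    rw [excN, Finset.card_filter]
    obtain ⟨k, rfl⟩ : ∃ k, n = k + 1 := ⟨n - 1, by omega⟩
    rw [Finset.sum_range_succ]
    simp only [Nat.add_sub_cancel] at hlast ⊢
    simp [hlast]
  omega

open Classical in
lemma VW0_iff {n N : ℕ} (σ : Equiv.Perm (Fin n)) (c : Fin n → Fin (2 * N)) :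
    VW 0 c σ ↔ (∀ i, (Odd (c i : ℕ) ↔ i < σ i)) ∧
      ∀ i j : Fin n, i < j → (c j : ℕ) / 2 + (if DEX σ i then 1 else 0) ≤ (c i : ℕ) / 2 := by
  constructor
  · rintro ⟨ha, hi, hv⟩
    have hodd : ∀ i, (Odd (c i : ℕ) ↔ i < σ i) := by
      intro i
      constructor
      · intro ho
        obtain ⟨h1, h2⟩ := (hv i).1 ho
        refine lt_of_le_of_ne h1 fun e => ?_
        exact absurd (h2 e.symm) (by omega)
      · intro h
        by_contra ho
        exact absurd ((hv i).2 ho) (not_le.mpr h)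
    refine ⟨hodd, fun i j hij => ?_⟩
    have hij' : (i : ℕ) < j := hij
    have hj := j.2
    set k : Fin n := ⟨i + 1, by omega⟩ with hk
    have h1 : (c j : ℕ) ≤ c k := ha (show k ≤ j from by rw [Fin.le_def]; simp [hk]; omega)
    have hik : i < k := by rw [Fin.lt_def]; simp [hk]
    have h2 : (c k : ℕ) ≤ c i := ha hik.le
    have h3 := hi i k hik
    have o1 := hodd i
    have o2 := hodd k
    have hki : (k : ℕ) = i + 1 := rfl
    have p1 := pf_val σ i
    have p2 := pf_val σ k
    rw [hki] at p2
    by_cases hD : DEX σ i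
    · rw [if_pos hD]
      unfold DEX at hD
      rw [p1, p2] at hD
      rw [Fin.lt_def] at o1 o2
      rw [hki] at o2
      rw [Nat.odd_iff] at o1 o2
      rw [Fin.ext_iff, Fin.lt_def] at h3
      omega
    · rw [if_neg hD]
      omega
  · rintro ⟨hodd, hch⟩
    have hadj : ∀ i k : Fin n, (k : ℕ) = i + 1 → c k ≤ c i ∧ (c i = c k → σ i < σ k) := by
      intro i k hki
      have hik : i < k := by rw [Fin.lt_def]; omega
      have h := hch i k hik
      have o1 := hodd i
      have o2 := hodd k
      have p1 := pf_val σ i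
      have p2 := pf_val σ k
      rw [hki] at p2
      have hne : (σ i : ℕ) ≠ σ k := fun e => hik.ne (σ.injective (Fin.ext e))
      rw [Fin.lt_def] at o1 o2
      rw [hki] at o2
      rw [Nat.odd_iff] at o1 o2
      rw [Fin.le_def, Fin.ext_iff, Fin.lt_def]
      by_cases hD : DEX σ i
      · rw [if_pos hD] at h
        omega
      · rw [if_neg hD] at h
        unfold DEX at hD
        rw [p1, p2] at hD
        omega
    have hall : ∀ d : ℕ, ∀ i k : Fin n, (k : ℕ) = i + d + 1 → c k ≤ c i ∧ (c i = c k → σ i < σ k) := by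
      intro d
      induction d with
      | zero => intro i k h; exact hadj i k h
      | succ d ih =>
        intro i k h
        have hk := k.2
        obtain ⟨a1, a2⟩ := ih i ⟨i + d + 1, by omega⟩ rfl
        obtain ⟨b1, b2⟩ := hadj ⟨i + d + 1, by omega⟩ k (by simp; omega)
        refine ⟨b1.trans a1, fun e => ?_⟩
        have e1 : c i = c ⟨i + d + 1, by omega⟩ := le_antisymm (e ▸ b1) a1
        exact (a2 e1).trans (b2 (e1 ▸ e))
    have hlt : ∀ i k : Fin n, i < k → c k ≤ c i ∧ (c i = c k → σ i < σ k) := by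
      intro i k hik
      have : (i : ℕ) < k := hik
      exact hall (k - i - 1) i k (by omega)
    refine ⟨?_, fun i j hij => (hlt i j hij).2, fun i => ⟨fun ho => ?_, fun ho => ?_⟩⟩
    · intro i j hij
      rcases hij.eq_or_lt with rfl | h
      · exact le_rfl
      · exact (hlt i j h).1
    · have := (hodd i).1 ho
      exact ⟨this.le, fun e => absurd e this.ne'⟩
    · by_contra h
      exact ho ((hodd i).2 (not_le.mp h))

open Classical in
lemma sum_c (t q : ℝ) {n N : ℕ} (σ : Equiv.Perm (Fin n)) :
    ∑ c : Fin n → Fin (2 * N), (if VW 0 c σ then ∏ i, wl t q (c i) else 0) =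
      t ^ excN σ * RR q N n N (DEX σ) := by
  rw [RR, Finset.mul_sum, ← Finset.sum_filter]
  have hexc : t ^ excN σ = ∏ i : Fin n, if i < σ i then t else 1 := by
    rw [Finset.prod_ite, Finset.prod_const, Finset.prod_const_one, mul_one, excN]
    congr 1
    symm
    refine Finset.card_bij (fun i _ => (i : ℕ)) ?_ ?_ ?_
    · intro i hi
      simp only [Finset.mem_filter, Finset.mem_univ, true_and, Finset.mem_range] at hi ⊢
      rw [pf_val]; exact ⟨i.2, hi⟩
    · intro i _ j _ h; exact Fin.ext h
    · intro i hi
      simp only [Finset.mem_filter, Finset.mem_range] at hi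
      refine ⟨⟨i, hi.1⟩, ?_, rfl⟩
      have := pf_val σ ⟨i, hi.1⟩
      simp only at this
      simp only [Finset.mem_filter, Finset.mem_univ, true_and]
      rw [Fin.lt_def, ← this]; exact hi.2
  simp only [mul_ite, mul_zero]
  rw [← Finset.sum_filter]
  refine Finset.sum_bij' (fun c _ i => (⟨(c i : ℕ) / 2, by have := (c i).2; omega⟩ : Fin N))
    (fun b _ i => (⟨2 * (b i : ℕ) + (if i < σ i then 1 else 0), by have := (b i).2; split_ifs <;> omega⟩ : Fin (2 * N))) ?_ ?_ ?_ ?_ ?_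
  · intro c hc
    simp only [Finset.mem_filter, Finset.mem_univ, true_and] at hc ⊢
    rw [VW0_iff] at hc
    exact ⟨fun i => by have := (c i).2; omega, hc.2⟩
  · intro b hb
    simp only [Finset.mem_filter, Finset.mem_univ, true_and] at hb ⊢
    rw [VW0_iff]
    refine ⟨fun i => ?_, fun i j hij => ?_⟩
    · simp only [Nat.odd_iff]
      split_ifs with h <;> simp [h]
    · have := hb.2 i j hij
      have h1 : ∀ i, (2 * (b i : ℕ) + (if i < σ i then 1 else 0)) / 2 = b i := by
        intro i; split_ifs <;> omega
      simp only [h1]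
      exact this
  · intro c hc
    simp only [Finset.mem_filter, Finset.mem_univ, true_and] at hc
    rw [VW0_iff] at hc
    funext i
    ext
    have := hc.1 i
    rw [Nat.odd_iff] at this
    simp only
    split_ifs with h <;> simp [h] at this <;> omega
  · intro b hb
    funext i
    ext
    simp only
    split_ifs <;> omega
  · intro c hc
    simp only [Finset.mem_filter, Finset.mem_univ, true_and] at hc
    rw [VW0_iff] at hc
    rw [hexc, ← Finset.prod_mul_distrib]
    refine Finset.prod_congr rfl fun i _ => ?_
    have := hc.1 i
    by_cases h : i < σ i
    · simp [wl, this.2 h, h]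
    · simp [wl, mt this.1 h, h]

open Classical in
lemma WS0_eq (t q : ℝ) (n N : ℕ) : WS (wl t q) (2 * N) 0 n = ∑ σ : Equiv.Perm (Fin n),
    t ^ excN σ * q ^ (majN σ - excN σ) * Pq q n (N - ∑ i ∈ range (n - 1), if DEX σ i then 1 else 0) := by
  rw [WS, Finset.sum_comm]
  refine Finset.sum_congr rfl fun σ _ => ?_
  rw [sum_c, RR_eq q N n N le_rfl, DEX_sum]
  ring

end PPart

section Limit
open Filter Topology

/-- `(q;q)_n` -/
noncomputable def qf (q : ℝ) (n : ℕ) : ℝ := ∏ i ∈ range n, (1 - q ^ (i + 1))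

lemma qf_pos {q : ℝ} (h0 : 0 < q) (h1 : q < 1) (n : ℕ) : 0 < qf q n := by
  refine Finset.prod_pos fun i _ => ?_
  have := pow_lt_one₀ h0.le h1 (Nat.succ_ne_zero i)
  simp only [Nat.succ_eq_add_one] at this
  linarith

lemma Pq_lim {q : ℝ} (h0 : 0 < q) (h1 : q < 1) (n d : ℕ) :
    Tendsto (fun N : ℕ => Pq q n (N - d)) atTop (𝓝 (1 / qf q n)) := by
  have hp := qf_pos h0 h1 n
  have e : ∀ N : ℕ, Pq q n (N - d) = (∏ i ∈ range n, (1 - q ^ (N - d + i))) / qf q n := by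
    intro N
    rw [eq_div_iff hp.ne']
    exact Pq_closed q n (N - d)
  simp only [e]
  refine Tendsto.div_const ?_ _
  have this : Tendsto (fun N : ℕ => ∏ i ∈ range n, (1 - q ^ (N - d + i))) atTop (𝓝 (∏ i ∈ range n, ((1 : ℝ) - 0))) := ?_
  · simpa using this
  refine tendsto_finsetProd _ fun i _ => ?_
  refine Tendsto.sub tendsto_const_nhds ?_
  have h := tendsto_pow_atTop_nhds_zero_of_lt_one h0.le h1
  refine h.comp ?_
  exact tendsto_atTop_mono (fun N => Nat.le_add_right (N - d) i) (tendsto_sub_atTop_nat d)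

lemma WS0_lim {q : ℝ} (t : ℝ) (h0 : 0 < q) (h1 : q < 1) (n : ℕ) :
    Tendsto (fun N : ℕ => WS (wl t q) (2 * N) 0 n) atTop (𝓝 (Aq ℝ n t q / qf q n)) := by
  classical
  simp only [WS0_eq, Aq, Finset.sum_div]
  refine tendsto_finsetSum _ fun σ _ => ?_
  have := (Pq_lim h0 h1 n (∑ i ∈ range (n - 1), if DEX σ i then 1 else 0)).const_mul
    (t ^ excN σ * q ^ (majN σ - excN σ))
  rwa [mul_one_div] at this

/-- q-exponential -/
noncomputable def eS (q : ℝ) : PowerSeries ℝ := PowerSeries.mk fun n => 1 / qf q n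

lemma Ehat_eq {q : ℝ} (t : ℝ) (h0 : 0 < q) (h1 : q < 1) :
    PowerSeries.mk (fun n => Aq ℝ n t q / qf q n) * (PowerSeries.rescale t (eS q) - PowerSeries.C t * eS q) =
      PowerSeries.C (1 - t) * eS q := by
  have hN : ∀ N : ℕ, PowerSeries.mk (WS (wl t q) (2 * N) 0) *
      (PowerSeries.mk (fun n => t ^ n * Pq q n N) - PowerSeries.C t * PowerSeries.mk (fun n => 1 ^ n * Pq q n N)) =
      PowerSeries.C (1 - t) * PowerSeries.mk (fun n => 1 ^ n * Pq q n N) := by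
    intro N
    have h1 := Pq_gf q 1 N
    have h2 := Pq_gf q t N
    have h3 := strict_gf t q N
    set H1 := PowerSeries.mk (fun n => 1 ^ n * Pq q n N)
    set Ht := PowerSeries.mk (fun n => t ^ n * Pq q n N)
    set W := PowerSeries.mk (WS (wl t q) (2 * N) 0)
    linear_combination H1 * Ht * h3 - (W * Ht) * h1 + (W * H1 * PowerSeries.C t + PowerSeries.C (1 - t) * H1) * h2
  ext n
  have hc : ∀ N : ℕ, ∑ p ∈ antidiagonal n, WS (wl t q) (2 * N) 0 p.1 * (t ^ p.2 * Pq q p.2 N - t * Pq q p.2 N) =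
      (1 - t) * Pq q n N := by
    intro N
    have := congrArg (PowerSeries.coeff n) (hN N)
    rw [PowerSeries.coeff_mul, PowerSeries.coeff_C_mul, PowerSeries.coeff_mk] at this
    simpa [PowerSeries.coeff_C_mul] using this
  have P0 : ∀ k, Tendsto (fun N : ℕ => Pq q k N) atTop (𝓝 (1 / qf q k)) := fun k => Pq_lim h0 h1 k 0
  have hL : Tendsto (fun N : ℕ => ∑ p ∈ antidiagonal n, WS (wl t q) (2 * N) 0 p.1 * (t ^ p.2 * Pq q p.2 N - t * Pq q p.2 N))
      atTop (𝓝 (∑ p ∈ antidiagonal n, Aq ℝ p.1 t q / qf q p.1 * (t ^ p.2 * (1 / qf q p.2) - t * (1 / qf q p.2)))) := by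
    refine tendsto_finsetSum _ fun p _ => ?_
    exact (WS0_lim t h0 h1 p.1).mul (((P0 p.2).const_mul _).sub ((P0 p.2).const_mul _))
  have hR : Tendsto (fun N : ℕ => (1 - t) * Pq q n N) atTop (𝓝 ((1 - t) * (1 / qf q n))) := (P0 n).const_mul _
  simp only [hc] at hL
  have := tendsto_nhds_unique hL hR
  rw [PowerSeries.coeff_mul, PowerSeries.coeff_C_mul]
  simp only [eS, map_sub, PowerSeries.coeff_mk, PowerSeries.coeff_rescale, PowerSeries.coeff_C_mul]
  exact this

end Limit

section Stats

/-- descents of a word -/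
def desF (n : ℕ) (f : ℕ → ℕ) : ℕ := ∑ i ∈ range (n - 1), if f (i + 1) < f i then 1 else 0

/-- admissible inversion predicate -/
def AIp (f : ℕ → ℕ) (i j : ℕ) : Prop :=
  i < j ∧ f j < f i ∧ ((0 < i ∧ f (i - 1) < f i) ∨ ∃ k < j, i < k ∧ f i < f k)

instance (f : ℕ → ℕ) (i j : ℕ) : Decidable (AIp f i j) := by unfold AIp; infer_instance

/-- admissible inversions of a word -/
def aiF (n : ℕ) (f : ℕ → ℕ) : ℕ := ∑ i ∈ range n, ∑ j ∈ range n, if AIp f i j then 1 else 0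

/-- first ascent is at the minimum -/
def isPm (n : ℕ) (f : ℕ → ℕ) : Prop :=
  ∀ i, i + 1 < n → f i < f (i + 1) → (∀ j < i, ¬ f j < f (j + 1)) → ∀ m < n, f i ≤ f m

lemma desN_eq {n : ℕ} (π : Equiv.Perm (Fin n)) : desN π = desF n (pf π) := by
  rw [desN, desF, Finset.card_filter]

lemma aiN_eq {n : ℕ} (π : Equiv.Perm (Fin n)) : aiN π = aiF n (pf π) := by
  rw [aiN, aiF, Finset.card_filter, Finset.sum_product]
  rfl

lemma isPRW_iff {n : ℕ} (π : Equiv.Perm (Fin n)) : isPRW π ↔ isPm n (pf π) := by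
  constructor
  · intro h i hi hlt hf m _
    rw [h i (by omega) hi hlt hf]; exact Nat.zero_le _
  · intro h i hi hi' hlt hf
    have := h i hi' hlt hf
    set x : Fin n := π.symm ⟨0, by omega⟩
    have h2 := this x x.2
    rw [pf_val] at h2
    simp [x] at h2
    exact h2

lemma desF_congr (n : ℕ) (f g : ℕ → ℕ) (h : ∀ i < n, ∀ j < n, f i < f j ↔ g i < g j) :
    desF n f = desF n g := by
  unfold desF
  refine Finset.sum_congr rfl fun i hi => ?_
  have hi := mem_range.1 hi
  simp only [h (i + 1) (by omega) i (by omega)]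

lemma aiF_congr (n : ℕ) (f g : ℕ → ℕ) (h : ∀ i < n, ∀ j < n, f i < f j ↔ g i < g j) :
    aiF n f = aiF n g := by
  unfold aiF
  refine Finset.sum_congr rfl fun i hi => Finset.sum_congr rfl fun j hj => ?_
  have hi := mem_range.1 hi
  have hj := mem_range.1 hj
  have : AIp f i j ↔ AIp g i j := by
    unfold AIp
    rw [h j hj i hi, h (i - 1) (by omega) i hi]
    have : (∃ k < j, i < k ∧ f i < f k) ↔ (∃ k < j, i < k ∧ g i < g k) := by
      constructor
      · rintro ⟨k, h1, h2, h3⟩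
        exact ⟨k, h1, h2, (h i hi k (by omega)).1 h3⟩
      · rintro ⟨k, h1, h2, h3⟩
        exact ⟨k, h1, h2, (h i hi k (by omega)).2 h3⟩
    rw [this]
  simp only [this]

lemma isPm_congr (n : ℕ) (f g : ℕ → ℕ) (h : ∀ i < n, ∀ j < n, f i < f j ↔ g i < g j) :
    isPm n f ↔ isPm n g := by
  unfold isPm
  refine forall_congr' fun i => forall_congr' fun hi => ?_
  rw [h i (by omega) (i + 1) hi]
  refine forall_congr' fun _ => ?_
  have e1 : (∀ j < i, ¬ f j < f (j + 1)) ↔ (∀ j < i, ¬ g j < g (j + 1)) :=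
    forall_congr' fun j => forall_congr' fun hj => by rw [h j (by omega) (j + 1) (by omega)]
  have e2 : (∀ m < n, f i ≤ f m) ↔ (∀ m < n, g i ≤ g m) :=
    forall_congr' fun m => forall_congr' fun hm => by
      rw [← not_lt, ← not_lt, h m hm i (by omega)]
  rw [e1, e2]

lemma desF_concat (k r : ℕ) (f : ℕ → ℕ) (h1 : ∀ i < k, f i < f k) (h2 : ∀ j < r, f (k + 1 + j) < f k) :
    desF (k + 1 + r) f = desF k f + desF r (fun j => f (k + 1 + j)) + (if 0 < r then 1 else 0) := by
  unfold desF
  have e : k + 1 + r - 1 = k + r := by omega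
  rw [e, Finset.sum_range_add]
  have a1 : (∑ i ∈ range k, if f (i + 1) < f i then 1 else 0) = ∑ i ∈ range (k - 1), if f (i + 1) < f i then 1 else 0 := by
    cases k with
    | zero => rfl
    | succ k =>
      rw [Finset.sum_range_succ]
      have := h1 k (by omega)
      simp only [Nat.add_sub_cancel]
      rw [if_neg (by omega), add_zero]
  rw [a1, add_assoc]
  congr 1
  cases r with
  | zero => simp
  | succ r =>
    rw [Finset.sum_range_succ']
    have := h2 0 (by omega)
    simp only [Nat.add_sub_cancel]
    congr 1
    · refine Finset.sum_congr rfl fun i _ => ?_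
      rw [show k + (i + 1) + 1 = k + 1 + (i + 1) by ring, show k + (i + 1) = k + 1 + i by ring]
    · simpa using this

lemma aiF_concat (k r : ℕ) (f : ℕ → ℕ) (h1 : ∀ i < k, f i < f k) (h2 : ∀ j < r, f (k + 1 + j) < f k) :
    aiF (k + 1 + r) f = aiF k f + aiF r (fun j => f (k + 1 + j)) +
      (∑ i ∈ range k, ∑ j ∈ range r, if f (k + 1 + j) < f i then 1 else 0) + (if 0 < k then r else 0) := by
  unfold aiF
  simp only [Finset.sum_range_add _ (k + 1) r, Finset.sum_range_succ _ k, Finset.sum_add_distrib]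
  have b1 : (∑ i ∈ range k, if AIp f i k then 1 else 0) = 0 := by
    refine Finset.sum_eq_zero fun i hi => if_neg ?_
    rintro ⟨_, h, _⟩
    have := h1 i (mem_range.1 hi); omega
  have b2 : (∑ j ∈ range k, if AIp f k j then 1 else 0) = 0 := by
    refine Finset.sum_eq_zero fun i hi => if_neg ?_
    rintro ⟨h, _⟩
    have := mem_range.1 hi; omega
  have b3 : (if AIp f k k then 1 else 0) = 0 := if_neg (fun h => lt_irrefl _ h.1)
  have b4 : (∑ j ∈ range r, if AIp f k (k + 1 + j) then 1 else 0) = if 0 < k then r else 0 := by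
    by_cases hk : 0 < k
    · rw [if_pos hk, Finset.sum_congr rfl (g := fun _ => 1)]
      · simp
      · intro j hj
        rw [if_pos]
        exact ⟨by omega, h2 j (mem_range.1 hj), Or.inl ⟨hk, h1 (k - 1) (by omega)⟩⟩
    · rw [if_neg hk]
      refine Finset.sum_eq_zero fun j hj => if_neg ?_
      rintro ⟨_, _, h | ⟨m, hm1, hm2, hm3⟩⟩
      · exact hk h.1
      · have := h2 (m - (k + 1)) (by have := mem_range.1 hj; omega)
        rw [show k + 1 + (m - (k + 1)) = m by omega] at this
        omega
  have b5 : (∑ i ∈ range r, ∑ j ∈ range k, if AIp f (k + 1 + i) j then 1 else 0) = 0 := by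
    refine Finset.sum_eq_zero fun i _ => Finset.sum_eq_zero fun j hj => if_neg ?_
    rintro ⟨h, _⟩
    have := mem_range.1 hj; omega
  have b6 : (∑ i ∈ range r, if AIp f (k + 1 + i) k then 1 else 0) = 0 := by
    refine Finset.sum_eq_zero fun i _ => if_neg ?_
    rintro ⟨h, _⟩; omega
  have b7 : (∑ i ∈ range k, ∑ j ∈ range r, if AIp f i (k + 1 + j) then 1 else 0) =
      ∑ i ∈ range k, ∑ j ∈ range r, if f (k + 1 + j) < f i then 1 else 0 := by
    refine Finset.sum_congr rfl fun i hi => Finset.sum_congr rfl fun j hj => ?_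
    have hi := mem_range.1 hi
    have : AIp f i (k + 1 + j) ↔ f (k + 1 + j) < f i :=
      ⟨fun h => h.2.1, fun h => ⟨by omega, h, Or.inr ⟨k, by omega, hi, h1 i hi⟩⟩⟩
    simp only [this]
  have b8 : (∑ i ∈ range r, ∑ j ∈ range r, if AIp f (k + 1 + i) (k + 1 + j) then 1 else 0) =
      ∑ i ∈ range r, ∑ j ∈ range r, if AIp (fun j => f (k + 1 + j)) i j then 1 else 0 := by
    refine Finset.sum_congr rfl fun i hi => Finset.sum_congr rfl fun j hj => ?_
    have hi := mem_range.1 hi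
    have : AIp f (k + 1 + i) (k + 1 + j) ↔ AIp (fun j => f (k + 1 + j)) i j := by
      unfold AIp
      have c1 : (k + 1 + i < k + 1 + j) ↔ i < j := by omega
      have c2 : (0 < k + 1 + i ∧ f (k + 1 + i - 1) < f (k + 1 + i)) ↔ (0 < i ∧ f (k + 1 + (i - 1)) < f (k + 1 + i)) := by
        rcases Nat.eq_zero_or_pos i with rfl | hpos
        · have := h2 0 hi
          simp only [Nat.add_zero, Nat.add_sub_cancel] at this ⊢
          omega
        · rw [show k + 1 + i - 1 = k + 1 + (i - 1) by omega]
          simp [hpos]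
      have c3 : (∃ m < k + 1 + j, k + 1 + i < m ∧ f (k + 1 + i) < f m) ↔
          (∃ m < j, i < m ∧ f (k + 1 + i) < f (k + 1 + m)) := by
        constructor
        · rintro ⟨m, a, b, c⟩
          refine ⟨m - (k + 1), by omega, by omega, ?_⟩
          rwa [show k + 1 + (m - (k + 1)) = m by omega]
        · rintro ⟨m, a, b, c⟩
          exact ⟨k + 1 + m, by omega, by omega, c⟩
      rw [c1, c2, c3]
    simp only [this]
  rw [b1, b2, b3, b4, b5, b6, b7, b8]
  omega

lemma isPm_concat (k r : ℕ) (hk : 0 < k) (f : ℕ → ℕ) (h1 : ∀ i < k, f i < f k) (h2 : ∀ j < r, f (k + 1 + j) < f k) :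
    isPm (k + 1 + r) f ↔ isPm k f ∧ ∃ m < k, ∀ j < k + 1 + r, f m ≤ f j := by
  classical
  have hex : ∃ i, f i < f (i + 1) := ⟨k - 1, by
    have := h1 (k - 1) (by omega)
    rwa [show k - 1 + 1 = k by omega]⟩
  set i0 := Nat.find hex with hi0
  have hs : f i0 < f (i0 + 1) := Nat.find_spec hex
  have hm : ∀ j < i0, ¬ f j < f (j + 1) := fun j hj => Nat.find_min hex hj
  have hle : i0 ≤ k - 1 := Nat.find_le (by
    have := h1 (k - 1) (by omega)
    rwa [show k - 1 + 1 = k by omega])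
  have huniq : ∀ i, f i < f (i + 1) → (∀ j < i, ¬ f j < f (j + 1)) → i = i0 := by
    intro i a b
    by_contra hne
    rcases lt_or_gt_of_ne hne with h | h
    · exact hm i h a
    · exact b i0 h hs
  constructor
  · intro h
    have hall := h i0 (by omega) hs hm
    refine ⟨fun i hi a b m hmk => ?_, i0, by omega, fun j hj => hall j hj⟩
    rw [huniq i a b]; exact hall m (by omega)
  · rintro ⟨hP, m, hmk, hmin⟩ i hi a b j hj
    rw [huniq i a b]
    refine le_trans ?_ (hmin j hj)
    by_cases hlt : i0 + 1 < k
    · exact hP i0 hlt hs hm m hmk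
    · have e : i0 = k - 1 := by omega
      -- decreasing up to i0
      have hdec : ∀ d, ∀ x, x + d = i0 → f i0 ≤ f x := by
        intro d
        induction d with
        | zero => intro x hx; rw [← hx]; simp
        | succ d ih =>
          intro x hx
          have := ih (x + 1) (by omega)
          have := hm x (by omega)
          omega
      exact hdec (i0 - m) m (by omega)

lemma isPm_concat0 (r : ℕ) (f : ℕ → ℕ) (h2 : ∀ j < r, f (1 + j) < f 0) :
    isPm (1 + r) f ↔ isPm r (fun j => f (1 + j)) := by
  constructor
  · intro h i hi a b m hm
    refine h (1 + i) (by omega) ?_ ?_ (1 + m) (by omega)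
    · exact a
    · intro j hj
      rcases Nat.eq_zero_or_pos j with rfl | hpos
      · have := h2 0 (by omega)
        simp only [zero_add, Nat.add_zero] at this ⊢
        omega
      · have := b (j - 1) (by omega)
        simp only at this
        rwa [show 1 + (j - 1) = j by omega, show 1 + (j - 1 + 1) = j + 1 by omega] at this
  · intro h i hi a b m hm
    rcases Nat.eq_zero_or_pos i with rfl | hpos
    · have := h2 0 (by omega)
      simp only [zero_add, Nat.add_zero] at this a
      omega
    · have key := h (i - 1) (by omega) (by
        simp only
        rwa [show 1 + (i - 1) = i by omega, show 1 + (i - 1 + 1) = i + 1 by omega]) (by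
        intro j hj
        have := b (1 + j) (by omega)
        exact this)
      simp only at key
      rw [show 1 + (i - 1) = i by omega] at key
      rcases Nat.eq_zero_or_pos m with rfl | hmpos
      · have h3 := h2 (i - 1) (by omega)
        rw [show 1 + (i - 1) = i by omega] at h3
        omega
      · have := key (m - 1) (by omega)
        rwa [show 1 + (m - 1) = m by omega] at this

/-- cross inversions -/
def crs {n : ℕ} (S T : Finset (Fin n)) : ℕ := ∑ s ∈ S, ∑ s' ∈ T \ S, if s' < s then 1 else 0

lemma crs_insert_both {n : ℕ} (a : Fin n) (S T : Finset (Fin n)) (ha : ∀ x ∈ T, a < x) (hST : S ⊆ T) :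
    crs (insert a S) (insert a T) = crs S T := by
  have haT : a ∉ T := fun h => lt_irrefl _ (ha a h)
  have haS : a ∉ S := fun h => haT (hST h)
  have e : insert a T \ insert a S = T \ S := by
    ext x; simp only [mem_sdiff, mem_insert]
    constructor
    · rintro ⟨h1 | h1, h2⟩
      · exact absurd (Or.inl h1) h2
      · exact ⟨h1, fun h => h2 (Or.inr h)⟩
    · rintro ⟨h1, h2⟩
      refine ⟨Or.inr h1, ?_⟩
      rintro (rfl | h)
      · exact haT h1
      · exact h2 h
  unfold crs
  rw [e, Finset.sum_insert haS, Finset.sum_eq_zero, zero_add]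
  intro s hs
  rw [if_neg]
  exact not_lt.mpr (ha s (mem_sdiff.1 hs).1).le

lemma crs_insert_right {n : ℕ} (a : Fin n) (S T : Finset (Fin n)) (ha : ∀ x ∈ T, a < x) (hST : S ⊆ T) :
    crs S (insert a T) = S.card + crs S T := by
  have haT : a ∉ T := fun h => lt_irrefl _ (ha a h)
  have haS : a ∉ S := fun h => haT (hST h)
  unfold crs
  rw [Finset.insert_sdiff_of_notMem _ haS, Finset.card_eq_sum_ones, ← Finset.sum_add_distrib]
  refine Finset.sum_congr rfl fun s hs => ?_
  rw [Finset.sum_insert (by simp [haT]), if_pos (ha s (hST hs))]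

lemma gauss_zero {R : Type*} [CommRing R] (q : R) (n : ℕ) : gaussR q n 0 = 1 := by
  cases n <;> simp [gaussR]

lemma gauss_with {R : Type*} [CommRing R] (q : R) {n : ℕ} (a : Fin n) (T : Finset (Fin n)) (ha : ∀ x ∈ T, a < x) (k : ℕ) :
    ∑ S ∈ (powersetCard k T).image (insert a), q ^ crs S (insert a T) = ∑ S ∈ powersetCard k T, q ^ crs S T := by
  have haT : a ∉ T := fun h => lt_irrefl _ (ha a h)
  rw [Finset.sum_image]
  · refine Finset.sum_congr rfl fun S hS => ?_
    rw [crs_insert_both a S T ha (mem_powersetCard.1 hS).1]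
  · intro S hS S' hS' h
    have h1 : a ∉ S := fun h => haT ((mem_powersetCard.1 hS).1 h)
    have h2 : a ∉ S' := fun h => haT ((mem_powersetCard.1 hS').1 h)
    rw [← Finset.erase_insert h1, ← Finset.erase_insert h2]
    exact congrArg (fun X => Finset.erase X a) h

lemma gauss_sum {R : Type*} [CommRing R] (q : R) {n : ℕ} (T : Finset (Fin n)) :
    ∀ k, ∑ S ∈ powersetCard k T, q ^ crs S T = gaussR q T.card k := by
  induction T using Finset.induction_on_min with
  | empty =>
    intro k
    cases k with
    | zero => simp [gaussR, crs]
    | succ k => rw [Finset.powersetCard_eq_empty.mpr (by simp)]; simp [gaussR]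
  | insert a T ha ih =>
    have haT : a ∉ T := fun h => lt_irrefl _ (ha a h)
    intro k
    cases k with
    | zero => simp [gauss_zero, crs]
    | succ k =>
      rw [Finset.powersetCard_succ_insert haT, Finset.sum_union, gauss_with q a T ha, ih,
        Finset.card_insert_of_notMem haT, gaussR, add_comm]
      · congr 1
        rw [← ih, Finset.mul_sum]
        refine Finset.sum_congr rfl fun S hS => ?_
        rw [crs_insert_right a S T ha (mem_powersetCard.1 hS).1, (mem_powersetCard.1 hS).2, pow_add]
      · rw [Finset.disjoint_left]
        intro S hS hS'
        obtain ⟨S', _, rfl⟩ := mem_image.1 hS'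
        exact haT ((mem_powersetCard.1 hS).1 (mem_insert_self a S'))

lemma gauss_univ {R : Type*} [CommRing R] (q : R) (n k : ℕ) :
    ∑ S ∈ powersetCard k (univ : Finset (Fin n)), q ^ crs S univ = gaussR q n k := by
  rw [gauss_sum]; simp

lemma gauss_univ0 {R : Type*} [CommRing R] (q : R) (n k : ℕ) :
    ∑ S ∈ powersetCard (k + 1) (univ : Finset (Fin (n + 1))), (if (0 : Fin (n + 1)) ∈ S then q ^ crs S univ else 0) = gaussR q n k := by
  set T : Finset (Fin (n + 1)) := univ.erase 0 with hT
  have hu : (univ : Finset (Fin (n + 1))) = insert 0 T := by rw [hT, Finset.insert_erase (mem_univ _)]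
  have h0T : (0 : Fin (n + 1)) ∉ T := by simp [hT]
  have ha : ∀ x ∈ T, (0 : Fin (n + 1)) < x := by
    intro x hx
    exact Fin.pos_iff_ne_zero.mpr (Finset.ne_of_mem_erase hx)
  have hc : T.card = n := by rw [hT, Finset.card_erase_of_mem (mem_univ _)]; simp
  rw [hu, Finset.powersetCard_succ_insert h0T, Finset.sum_union]
  · rw [Finset.sum_eq_zero, zero_add]
    · rw [Finset.sum_congr rfl (g := fun S => q ^ crs S (insert 0 T)), gauss_with q 0 T ha, gauss_sum, hc]
      intro S hS
      obtain ⟨S', _, rfl⟩ := mem_image.1 hS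
      rw [if_pos (mem_insert_self _ _)]
    · intro S hS
      rw [if_neg]
      intro h; exact h0T ((mem_powersetCard.1 hS).1 h)
  · rw [Finset.disjoint_left]
    intro S hS hS'
    obtain ⟨S', _, rfl⟩ := mem_image.1 hS'
    exact h0T ((mem_powersetCard.1 hS).1 (mem_insert_self _ S'))

end Stats

section Bij

lemma desF_idx {m m' : ℕ} (h : m = m') (f : ℕ → ℕ) : desF m f = desF m' f := by rw [h]

lemma aiF_idx {m m' : ℕ} (h : m = m') (f : ℕ → ℕ) : aiF m f = aiF m' f := by rw [h]

lemma isPm_idx {m m' : ℕ} (h : m = m') (f : ℕ → ℕ) : isPm m f ↔ isPm m' f := by rw [h]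

/-- insert the maximum at position `k` -/
def insMax {n : ℕ} (k : Fin (n + 1)) (π : Equiv.Perm (Fin n)) : Equiv.Perm (Fin (n + 1)) :=
  (finSuccEquiv' k).trans ((Equiv.optionCongr π).trans (finSuccEquiv' (Fin.last n)).symm)

lemma insMax_self {n : ℕ} (k : Fin (n + 1)) (π : Equiv.Perm (Fin n)) : insMax k π k = Fin.last n := by
  simp [insMax]

lemma insMax_succAbove {n : ℕ} (k : Fin (n + 1)) (π : Equiv.Perm (Fin n)) (i : Fin n) :
    insMax k π (k.succAbove i) = (π i).castSucc := by
  simp [insMax]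

lemma sum_insMax {R : Type*} [CommRing R] {n : ℕ} (F : Equiv.Perm (Fin (n + 1)) → R) :
    ∑ π, F π = ∑ k : Fin (n + 1), ∑ π : Equiv.Perm (Fin n), F (insMax k π) := by
  rw [← Fintype.sum_prod_type']
  symm
  refine Fintype.sum_bijective (fun x : Fin (n + 1) × Equiv.Perm (Fin n) => insMax x.1 x.2) ?_ _ _ (fun x => rfl)
  rw [Fintype.bijective_iff_injective_and_card]
  constructor
  · rintro ⟨k, π⟩ ⟨k', π'⟩ h
    simp only at h
    have hk : k = k' := by
      have h1 := insMax_self k π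
      rw [h, ← insMax_self k' π'] at h1
      exact (insMax k' π').injective h1
    subst hk
    congr 1
    ext i
    have := congrArg (fun σ : Equiv.Perm (Fin (n + 1)) => σ (k.succAbove i)) h
    simp only [insMax_succAbove] at this
    exact congrArg Fin.val (Fin.castSucc_injective _ this)
  · simp [Fintype.card_perm, Nat.factorial_succ]

lemma compl_card {k r : ℕ} (S : Finset (Fin (k + r))) (hS : S.card = k) : Sᶜ.card = r := by
  rw [Finset.card_compl, hS]; simp

/-- shuffle -/
def shuf {k r : ℕ} (S : Finset (Fin (k + r))) (hS : S.card = k) (α : Equiv.Perm (Fin k)) (β : Equiv.Perm (Fin r)) :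
    Equiv.Perm (Fin (k + r)) :=
  finSumFinEquiv.symm.trans ((Equiv.sumCongr α β).trans (finSumEquivOfFinset hS (compl_card S hS)))

lemma shuf_left {k r : ℕ} (S : Finset (Fin (k + r))) (hS : S.card = k) (α : Equiv.Perm (Fin k)) (β : Equiv.Perm (Fin r))
    (i : Fin k) : shuf S hS α β (Fin.castAdd r i) = S.orderEmbOfFin hS (α i) := by
  simp [shuf]

lemma shuf_right {k r : ℕ} (S : Finset (Fin (k + r))) (hS : S.card = k) (α : Equiv.Perm (Fin k)) (β : Equiv.Perm (Fin r))
    (i : Fin r) : shuf S hS α β (Fin.natAdd k i) = Sᶜ.orderEmbOfFin (compl_card S hS) (β i) := by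
  simp [shuf]

lemma mem_shuf {k r : ℕ} (S : Finset (Fin (k + r))) (hS : S.card = k) (α : Equiv.Perm (Fin k)) (β : Equiv.Perm (Fin r))
    (x : Fin (k + r)) : x ∈ S ↔ ∃ i : Fin k, shuf S hS α β (Fin.castAdd r i) = x := by
  simp only [shuf_left]
  rw [← Finset.mem_coe, ← Finset.range_orderEmbOfFin S hS]
  constructor
  · rintro ⟨i, rfl⟩; exact ⟨α.symm i, by simp⟩
  · rintro ⟨i, rfl⟩; exact ⟨α i, rfl⟩

lemma sum_shuf {R : Type*} [CommRing R] {k r : ℕ} (F : Equiv.Perm (Fin (k + r)) → R) :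
    ∑ π, F π = ∑ S : {S : Finset (Fin (k + r)) // S.card = k}, ∑ α : Equiv.Perm (Fin k), ∑ β : Equiv.Perm (Fin r),
      F (shuf S.1 S.2 α β) := by
  have : ∀ S : {S : Finset (Fin (k + r)) // S.card = k}, ∑ α : Equiv.Perm (Fin k), ∑ β : Equiv.Perm (Fin r),
      F (shuf S.1 S.2 α β) = ∑ x : Equiv.Perm (Fin k) × Equiv.Perm (Fin r), F (shuf S.1 S.2 x.1 x.2) := fun S => by
    rw [Fintype.sum_prod_type]
  simp only [this]
  rw [← Fintype.sum_prod_type']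
  symm
  refine Fintype.sum_bijective (fun x : {S : Finset (Fin (k + r)) // S.card = k} × (Equiv.Perm (Fin k) × Equiv.Perm (Fin r)) =>
    shuf x.1.1 x.1.2 x.2.1 x.2.2) ?_ _ _ (fun x => rfl)
  rw [Fintype.bijective_iff_injective_and_card]
  constructor
  · rintro ⟨⟨S, hS⟩, α, β⟩ ⟨⟨S', hS'⟩, α', β'⟩ h
    simp only at h
    have hSS : S = S' := by
      ext x
      rw [mem_shuf S hS α β, mem_shuf S' hS' α' β', h]
    subst hSS
    have ha : α = α' := by
      ext i
      have := congrArg (fun σ : Equiv.Perm (Fin (k + r)) => σ (Fin.castAdd r i)) h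
      simp only [shuf_left] at this
      exact congrArg Fin.val ((S.orderEmbOfFin hS).injective this)
    have hb : β = β' := by
      ext i
      have := congrArg (fun σ : Equiv.Perm (Fin (k + r)) => σ (Fin.natAdd k i)) h
      simp only [shuf_right] at this
      exact congrArg Fin.val ((Sᶜ.orderEmbOfFin _).injective this)
    rw [ha, hb]
  · rw [Fintype.card_prod, Fintype.card_prod, Fintype.card_perm, Fintype.card_perm, Fintype.card_perm,
      Fintype.card_finset_len]
    simp only [Fintype.card_fin]
    rw [← Nat.add_choose_mul_factorial_mul_factorial k r, Nat.choose_symm_add, mul_assoc]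

/-- the position of the maximum -/
def kpos (k r : ℕ) : Fin (k + r + 1) := ⟨k, by omega⟩

section facts
variable {k r : ℕ} (S : Finset (Fin (k + r))) (hS : S.card = k) (α : Equiv.Perm (Fin k)) (β : Equiv.Perm (Fin r))

lemma pf_k : pf (insMax (kpos k r) (shuf S hS α β)) k = k + r := by
  have := pf_val (insMax (kpos k r) (shuf S hS α β)) (kpos k r)
  rw [insMax_self] at this
  simpa [kpos] using this

lemma pf_left (i : Fin k) : pf (insMax (kpos k r) (shuf S hS α β)) i = S.orderEmbOfFin hS (α i) := by
  have := pf_val (insMax (kpos k r) (shuf S hS α β)) ((kpos k r).succAbove (Fin.castAdd r i))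
  rw [insMax_succAbove, shuf_left] at this
  have e : (((kpos k r).succAbove (Fin.castAdd r i) : Fin (k + r + 1)) : ℕ) = i := by
    rw [Fin.succAbove_of_castSucc_lt]
    · rfl
    · rw [Fin.lt_def]; simp [kpos]
  rw [e] at this
  simpa using this

lemma pf_right (j : Fin r) : pf (insMax (kpos k r) (shuf S hS α β)) (k + 1 + j) =
    Sᶜ.orderEmbOfFin (compl_card S hS) (β j) := by
  have := pf_val (insMax (kpos k r) (shuf S hS α β)) ((kpos k r).succAbove (Fin.natAdd k j))
  rw [insMax_succAbove, shuf_right] at this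
  have e : (((kpos k r).succAbove (Fin.natAdd k j) : Fin (k + r + 1)) : ℕ) = k + 1 + j := by
    rw [Fin.succAbove_of_le_castSucc]
    · simp; omega
    · rw [Fin.le_def]; simp [kpos]
  rw [e] at this
  simpa using this

lemma pf_left_lt (i : ℕ) (hi : i < k) : pf (insMax (kpos k r) (shuf S hS α β)) i < pf (insMax (kpos k r) (shuf S hS α β)) k := by
  have := pf_left S hS α β ⟨i, hi⟩
  simp only at this
  rw [this, pf_k]
  exact Fin.is_lt _

lemma pf_right_lt (j : ℕ) (hj : j < r) : pf (insMax (kpos k r) (shuf S hS α β)) (k + 1 + j) < pf (insMax (kpos k r) (shuf S hS α β)) k := by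
  have := pf_right S hS α β ⟨j, hj⟩
  simp only at this
  rw [this, pf_k]
  exact Fin.is_lt _

lemma ord_left (i : ℕ) (hi : i < k) (j : ℕ) (hj : j < k) :
    pf (insMax (kpos k r) (shuf S hS α β)) i < pf (insMax (kpos k r) (shuf S hS α β)) j ↔ pf α i < pf α j := by
  have h1 := pf_left S hS α β ⟨i, hi⟩
  have h2 := pf_left S hS α β ⟨j, hj⟩
  simp only at h1 h2
  rw [h1, h2, ← Fin.lt_def, OrderEmbedding.lt_iff_lt, Fin.lt_def]
  simp [pf, hi, hj]

lemma ord_right (i : ℕ) (hi : i < r) (j : ℕ) (hj : j < r) :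
    pf (insMax (kpos k r) (shuf S hS α β)) (k + 1 + i) < pf (insMax (kpos k r) (shuf S hS α β)) (k + 1 + j) ↔ pf β i < pf β j := by
  have h1 := pf_right S hS α β ⟨i, hi⟩
  have h2 := pf_right S hS α β ⟨j, hj⟩
  simp only at h1 h2
  rw [h1, h2, ← Fin.lt_def, OrderEmbedding.lt_iff_lt, Fin.lt_def]
  simp [pf, hi, hj]

lemma des_comb : desN (insMax (kpos k r) (shuf S hS α β)) = desN α + desN β + (if 0 < r then 1 else 0) := by
  rw [desN_eq, desN_eq, desN_eq, desF_idx (show k + r + 1 = k + 1 + r by ring),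
    desF_concat k r _ (pf_left_lt S hS α β) (pf_right_lt S hS α β),
    desF_congr k _ _ (ord_left S hS α β), desF_congr r _ (pf β) (ord_right S hS α β)]

lemma crs_comb : (∑ i ∈ range k, ∑ j ∈ range r, if pf (insMax (kpos k r) (shuf S hS α β)) (k + 1 + j) <
    pf (insMax (kpos k r) (shuf S hS α β)) i then 1 else 0) = crs S univ := by
  rw [← Fin.sum_univ_eq_sum_range (fun i => ∑ j ∈ range r, if pf (insMax (kpos k r) (shuf S hS α β)) (k + 1 + j) <
    pf (insMax (kpos k r) (shuf S hS α β)) i then 1 else 0) k]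
  have h1 : ∀ i : Fin k, (∑ j ∈ range r, if pf (insMax (kpos k r) (shuf S hS α β)) (k + 1 + j) <
    pf (insMax (kpos k r) (shuf S hS α β)) i then 1 else 0) =
    ∑ s' ∈ univ \ S, if s' < S.orderEmbOfFin hS (α i) then 1 else 0 := by
    intro i
    rw [← Fin.sum_univ_eq_sum_range (fun j => if pf (insMax (kpos k r) (shuf S hS α β)) (k + 1 + j) <
      pf (insMax (kpos k r) (shuf S hS α β)) i then 1 else 0) r]
    simp only [pf_left, pf_right, ← Fin.lt_def]
    rw [Equiv.sum_comp β (fun j => if Sᶜ.orderEmbOfFin (compl_card S hS) j < S.orderEmbOfFin hS (α i) then 1 else 0)]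
    rw [← Finset.compl_eq_univ_sdiff]
    conv_rhs => rw [← Finset.map_orderEmbOfFin_univ Sᶜ (compl_card S hS), Finset.sum_map]
    refine Finset.sum_congr rfl fun j _ => ?_
    simp
  simp only [h1]
  rw [Equiv.sum_comp α (fun i => ∑ s' ∈ univ \ S, if s' < S.orderEmbOfFin hS i then 1 else 0)]
  unfold crs
  conv_rhs => rw [← Finset.map_orderEmbOfFin_univ S hS, Finset.sum_map]
  refine Finset.sum_congr rfl fun i _ => ?_
  simp

lemma ai_comb : aiN (insMax (kpos k r) (shuf S hS α β)) = aiN α + aiN β + crs S univ + (if 0 < k then r else 0) := by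
  rw [aiN_eq, aiN_eq, aiN_eq, aiF_idx (show k + r + 1 = k + 1 + r by ring),
    aiF_concat k r _ (pf_left_lt S hS α β) (pf_right_lt S hS α β),
    aiF_congr k _ _ (ord_left S hS α β), aiF_congr r _ (pf β) (ord_right S hS α β), crs_comb]

lemma prw_comb (hk : 0 < k) : isPRW (insMax (kpos k r) (shuf S hS α β)) ↔ isPRW α ∧ ∃ s ∈ S, (s : ℕ) = 0 := by
  rw [isPRW_iff, isPRW_iff, isPm_idx (show k + r + 1 = k + 1 + r by ring),
    isPm_concat k r hk _ (pf_left_lt S hS α β) (pf_right_lt S hS α β),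
    isPm_congr k _ _ (ord_left S hS α β)]
  refine and_congr_right fun _ => ?_
  set π := insMax (kpos k r) (shuf S hS α β) with hπ
  constructor
  · rintro ⟨m, hm, hall⟩
    have h0 : pf π m = 0 := by
      set x : Fin (k + r + 1) := π.symm ⟨0, by omega⟩
      have h2 := hall x (by have := x.2; omega)
      rw [pf_val] at h2
      simp [x] at h2
      exact h2
    have h1 := pf_left S hS α β ⟨m, hm⟩
    simp only [← hπ] at h1
    exact ⟨_, Finset.orderEmbOfFin_mem S hS (α ⟨m, hm⟩), by rw [← h1, h0]⟩
  · rintro ⟨s, hs, hs0⟩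
    rw [mem_shuf S hS α β] at hs
    obtain ⟨i, hi⟩ := hs
    refine ⟨i, i.2, fun j _ => ?_⟩
    rw [pf_left S hS α β i, ← shuf_left S hS α β i, hi, hs0]
    exact Nat.zero_le _

end facts

/-- (des, ai) polynomial -/
def aP (R : Type*) [CommRing R] (t q : R) (n : ℕ) : R := ∑ π : Equiv.Perm (Fin n), t ^ desN π * q ^ aiN π

/-- (des, ai) polynomial over PRW -/
def pP (R : Type*) [CommRing R] (t q : R) (n : ℕ) : R :=
  ∑ π : Equiv.Perm (Fin n), if isPRW π then t ^ desN π * q ^ aiN π else 0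

lemma sum_subtype_card {R : Type*} [CommRing R] {n k : ℕ} (F : Finset (Fin n) → R) :
    ∑ S : {S : Finset (Fin n) // S.card = k}, F S.1 = ∑ S ∈ powersetCard k univ, F S := by
  exact (Finset.sum_subtype (powersetCard k univ) (by simp [mem_powersetCard]) F).symm

lemma term_a {R : Type*} [CommRing R] (t q : R) (k r : ℕ) :
    ∑ π : Equiv.Perm (Fin (k + r)), t ^ desN (insMax (kpos k r) π) * q ^ aiN (insMax (kpos k r) π) =
      gaussR q (k + r) k * ((if 0 < r then t else 1) * (if 0 < k then q ^ r else 1)) * (aP R t q k * aP R t q r) := by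
  rw [sum_shuf]
  simp only [des_comb, ai_comb]
  rw [← gauss_univ, ← sum_subtype_card, Finset.sum_mul, Finset.sum_mul]
  refine Finset.sum_congr rfl fun S _ => ?_
  rw [aP, aP, Finset.sum_mul_sum, Finset.mul_sum]
  refine Finset.sum_congr rfl fun α _ => ?_
  rw [Finset.mul_sum]
  refine Finset.sum_congr rfl fun β _ => ?_
  by_cases h1 : 0 < r <;> by_cases h2 : 0 < k <;> simp [h1, h2, pow_add] <;> ring

lemma gauss_univ0' {R : Type*} [CommRing R] (q : R) (m k : ℕ) (hm : 0 < m) :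
    ∑ S ∈ powersetCard (k + 1) (univ : Finset (Fin m)), (if ∃ s ∈ S, (s : ℕ) = 0 then q ^ crs S univ else 0) = gaussR q (m - 1) k := by
  obtain ⟨n, rfl⟩ : ∃ n, m = n + 1 := ⟨m - 1, by omega⟩
  rw [Nat.add_sub_cancel, ← gauss_univ0]
  refine Finset.sum_congr rfl fun S _ => ?_
  have : (∃ s ∈ S, (s : ℕ) = 0) ↔ (0 : Fin (n + 1)) ∈ S := by
    constructor
    · rintro ⟨s, hs, h0⟩
      have : s = 0 := Fin.ext h0
      rwa [this] at hs
    · intro h; exact ⟨0, h, rfl⟩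
  simp only [this]

lemma term_p {R : Type*} [CommRing R] (t q : R) (k r : ℕ) :
    ∑ π : Equiv.Perm (Fin (k + 1 + r)), (if isPRW (insMax (kpos (k + 1) r) π) then
      t ^ desN (insMax (kpos (k + 1) r) π) * q ^ aiN (insMax (kpos (k + 1) r) π) else 0) =
      gaussR q (k + r) k * ((if 0 < r then t else 1) * q ^ r) * (pP R t q (k + 1) * aP R t q r) := by
  rw [sum_shuf]
  simp only [des_comb, ai_comb, prw_comb _ _ _ _ (Nat.succ_pos k)]
  have e : gaussR q (k + r) k = ∑ S ∈ powersetCard (k + 1) (univ : Finset (Fin (k + 1 + r))),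
      (if ∃ s ∈ S, (s : ℕ) = 0 then q ^ crs S univ else 0) := by
    rw [gauss_univ0' q _ k (by omega)]
    congr 1; omega
  rw [e, ← sum_subtype_card, Finset.sum_mul, Finset.sum_mul]
  refine Finset.sum_congr rfl fun S _ => ?_
  rw [aP, pP, Finset.sum_mul_sum, Finset.mul_sum]
  refine Finset.sum_congr rfl fun α _ => ?_
  rw [Finset.mul_sum]
  refine Finset.sum_congr rfl fun β _ => ?_
  by_cases h1 : 0 < r <;> by_cases h2 : isPRW α <;> by_cases h3 : (∃ s ∈ S.1, (s : ℕ) = 0) <;> simp only [h1, h2, h3, if_true, if_false, true_and, false_and, and_self, Nat.succ_pos] <;> ring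

lemma insMax0 {n : ℕ} (π : Equiv.Perm (Fin n)) : pf (insMax 0 π) 0 = n ∧ ∀ j < n, pf (insMax 0 π) (1 + j) = pf π j := by
  constructor
  · have := pf_val (insMax 0 π) 0
    rw [insMax_self] at this
    simpa using this
  · intro j hj
    have := pf_val (insMax 0 π) ((0 : Fin (n + 1)).succAbove ⟨j, hj⟩)
    rw [insMax_succAbove] at this
    simp only [Fin.succAbove_zero, Fin.val_succ, Fin.val_castSucc] at this
    rw [show 1 + j = j + 1 from Nat.add_comm 1 j, this]
    simp [pf, hj]

lemma term_p0 {R : Type*} [CommRing R] (t q : R) (n : ℕ) :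
    ∑ π : Equiv.Perm (Fin n), (if isPRW (insMax 0 π) then t ^ desN (insMax 0 π) * q ^ aiN (insMax 0 π) else 0) =
      (if 0 < n then t else 1) * pP R t q n := by
  rw [pP, Finset.mul_sum]
  refine Finset.sum_congr rfl fun π _ => ?_
  obtain ⟨h0, hj⟩ := insMax0 π
  have hlt : ∀ j < n, pf (insMax 0 π) (0 + 1 + j) < pf (insMax 0 π) 0 := by
    intro j hjn
    rw [zero_add, h0, hj j hjn]; exact pf_lt π j hjn
  have ho : ∀ i < n, ∀ j < n, pf (insMax 0 π) (0 + 1 + i) < pf (insMax 0 π) (0 + 1 + j) ↔ pf π i < pf π j := by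
    intro i hi j hj'
    rw [zero_add, hj i hi, hj j hj']
  have e1 : desN (insMax 0 π) = desN π + if 0 < n then 1 else 0 := by
    rw [desN_eq, desN_eq, desF_idx (show n + 1 = 0 + 1 + n by ring), desF_concat 0 n _ (by intro i hi; omega) hlt,
      desF_congr n _ (pf π) ho]
    simp [desF]
  have e2 : aiN (insMax 0 π) = aiN π := by
    rw [aiN_eq, aiN_eq, aiF_idx (show n + 1 = 0 + 1 + n by ring), aiF_concat 0 n _ (by intro i hi; omega) hlt,
      aiF_congr n _ (pf π) ho]
    simp [aiF]
  have e3 : isPRW (insMax 0 π) ↔ isPRW π := by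
    rw [isPRW_iff, isPRW_iff, isPm_idx (show n + 1 = 1 + n by ring), isPm_concat0 n _ (by simpa using hlt)]
    exact isPm_congr n _ _ (by simpa using ho)
  rw [e1, e2]
  simp only [e3]
  by_cases h1 : 0 < n <;> by_cases h2 : isPRW π <;> simp [h1, h2] <;> ring

lemma rec_a {R : Type*} [CommRing R] (t q : R) (n : ℕ) :
    aP R t q (n + 1) = ∑ p ∈ antidiagonal n, gaussR q n p.1 *
      ((if 0 < p.2 then t else 1) * (if 0 < p.1 then q ^ p.2 else 1)) * (aP R t q p.1 * aP R t q p.2) := by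
  rw [Finset.Nat.sum_antidiagonal_eq_sum_range_succ_mk]
  rw [aP, sum_insMax, ← Fin.sum_univ_eq_sum_range (fun k => gaussR q n k * ((if 0 < n - k then t else 1) * (if 0 < k then q ^ (n - k) else 1)) * (aP R t q k * aP R t q (n - k)))]
  refine Finset.sum_congr rfl fun k _ => ?_
  obtain ⟨k, hk⟩ := k
  obtain ⟨r, rfl⟩ := Nat.exists_eq_add_of_le (Nat.lt_succ_iff.1 hk)
  simp only [Nat.add_sub_cancel_left]
  rw [← term_a]
  rfl

lemma rec_p {R : Type*} [CommRing R] (t q : R) (n : ℕ) :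
    pP R t q (n + 1 + 1) = t * pP R t q (n + 1) + ∑ p ∈ antidiagonal n, gaussR q n p.1 *
      ((if 0 < p.2 then t else 1) * q ^ p.2) * (pP R t q (p.1 + 1) * aP R t q p.2) := by
  rw [Finset.Nat.sum_antidiagonal_eq_sum_range_succ_mk]
  rw [pP, sum_insMax, Fin.sum_univ_succ, term_p0]
  rw [if_pos (Nat.succ_pos n)]
  congr 1
  rw [← Fin.sum_univ_eq_sum_range (fun k => gaussR q n k * ((if 0 < n - k then t else 1) * q ^ (n - k)) * (pP R t q (k + 1) * aP R t q (n - k)))]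
  refine Finset.sum_congr rfl fun k _ => ?_
  obtain ⟨k, hk⟩ := k
  obtain ⟨r, rfl⟩ := Nat.exists_eq_add_of_le (Nat.lt_succ_iff.1 hk)
  simp only [Nat.add_sub_cancel_left]
  rw [← term_p]
  have hh : k + r + 1 = k + 1 + r := by ring
  have gen : ∀ (m : ℕ) (h : m = k + 1 + r) (hk' : k + 1 < m + 1),
      ∑ π : Equiv.Perm (Fin m), (if isPRW (insMax ⟨k + 1, hk'⟩ π) then
        t ^ desN (insMax ⟨k + 1, hk'⟩ π) * q ^ aiN (insMax ⟨k + 1, hk'⟩ π) else 0) =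
      ∑ π : Equiv.Perm (Fin (k + 1 + r)), (if isPRW (insMax (kpos (k + 1) r) π) then
      t ^ desN (insMax (kpos (k + 1) r) π) * q ^ aiN (insMax (kpos (k + 1) r) π) else 0) := by
    intro m h hk'
    subst h
    rfl
  exact gen _ hh (by omega)

lemma aP_zero {R : Type*} [CommRing R] (t q : R) : aP R t q 0 = 1 := by
  simp [aP, desN, aiN]

lemma pP_one {R : Type*} [CommRing R] (t q : R) : pP R t q 1 = 1 := by
  have : ∀ π : Equiv.Perm (Fin 1), isPRW π := fun π i hi hi' => by omega
  have h2 : ∀ π : Equiv.Perm (Fin 1), aiN π = 0 := by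
    intro π
    rw [aiN_eq]
    simp [aiF, AIp]
  simp [pP, desN, this, h2]

end Bij

section FinalAlg

open PowerSeries in
lemma cc_rescale (a : ℝ) (f : PowerSeries ℝ) : constantCoeff (rescale a f) = constantCoeff f := by
  rw [← coeff_zero_eq_constantCoeff_apply, coeff_rescale, pow_zero, one_mul, coeff_zero_eq_constantCoeff_apply]

open PowerSeries in
lemma ser_uniq {q : ℝ} (h0 : 0 < q) (h1 : q < 1) (Y M : PowerSeries ℝ)
    (h : Y - rescale q Y = X * (Y * M)) (hc : coeff 0 Y = 0) : Y = 0 := by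
  ext n
  rw [map_zero]
  induction n using Nat.strong_induction_on with
  | _ n ih =>
    cases n with
    | zero => exact hc
    | succ n =>
      have h2 := congrArg (coeff (n + 1)) h
      rw [coeff_succ_X_mul, map_sub, coeff_rescale, coeff_mul] at h2
      rw [Finset.sum_eq_zero (fun p hp => by
        rw [ih p.1 (by have := mem_antidiagonal.1 hp; omega), zero_mul])] at h2
      have h3 : q ^ (n + 1) < 1 := pow_lt_one₀ h0.le h1 (by omega)
      have h4 : (1 - q ^ (n + 1)) * coeff (n + 1) Y = 0 := by linarith
      rcases mul_eq_zero.1 h4 with h5 | h5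
      · linarith
      · exact h5

lemma gauss_gt {R : Type*} [CommRing R] (q : R) (n k : ℕ) (h : n < k) : gaussR q n k = 0 := by
  induction n generalizing k with
  | zero => obtain ⟨k, rfl⟩ := Nat.exists_eq_succ_of_ne_zero (by omega : k ≠ 0); simp [gaussR]
  | succ n ih =>
    obtain ⟨k, rfl⟩ := Nat.exists_eq_succ_of_ne_zero (by omega : k ≠ 0)
    rw [Nat.succ_eq_add_one, gaussR, ih k (by omega), ih (k + 1) (by omega)]; simp

lemma qf_succ (q : ℝ) (n : ℕ) : qf q (n + 1) = qf q n * (1 - q ^ (n + 1)) := by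
  rw [qf, prod_range_succ]; rfl

lemma qf_zero (q : ℝ) : qf q 0 = 1 := by simp [qf]

lemma gauss_qf' (q : ℝ) (n : ℕ) : ∀ k r : ℕ, k + r = n → gaussR q n k * (qf q k * qf q r) = qf q n := by
  induction n with
  | zero =>
    intro k r h
    obtain ⟨rfl, rfl⟩ : k = 0 ∧ r = 0 := by omega
    simp [gaussR, qf_zero]
  | succ n ih =>
    intro k r h
    cases k with
    | zero =>
      obtain rfl : r = n + 1 := by omega
      simp [gaussR, qf_zero]
    | succ k =>
      rw [gaussR]
      have i1 := ih k r (by omega)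
      cases r with
      | zero =>
        obtain rfl : k = n := by omega
        rw [gauss_gt q k (k + 1) (by omega)]
        rw [qf_succ]
        linear_combination (1 - q ^ (k + 1)) * i1
      | succ r =>
        have i2 := ih (k + 1) r (by omega)
        obtain rfl : n = k + 1 + r := by omega
        rw [qf_succ q k, qf_succ q r] at *
        rw [qf_succ q (k + 1 + r)]
        linear_combination (1 - q ^ (k + 1)) * i1 + q ^ (k + 1) * (1 - q ^ (r + 1)) * i2

lemma gauss_qf {q : ℝ} (h0 : 0 < q) (h1 : q < 1) (n k r : ℕ) (h : k + r = n) :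
    gaussR q n k = qf q n * (1 / qf q k * (1 / qf q r)) := by
  have a := (qf_pos h0 h1 k).ne'
  have b := (qf_pos h0 h1 r).ne'
  rw [← gauss_qf' q n k r h]
  field_simp

open PowerSeries in
lemma eS_eq {q : ℝ} (h0 : 0 < q) (h1 : q < 1) : eS q - rescale q (eS q) = X * eS q := by
  ext n
  cases n with
  | zero => simp [eS, cc_rescale]
  | succ n =>
    rw [coeff_succ_X_mul, map_sub, coeff_rescale, eS, coeff_mk, coeff_mk]
    have a := (qf_pos h0 h1 n).ne'
    have b := (qf_pos h0 h1 (n + 1)).ne'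
    rw [qf_succ] at *
    have c : (1 - q ^ (n + 1)) ≠ 0 := right_ne_zero_of_mul b
    field_simp

/-- normalised generating series of the (des, ai) polynomials -/
noncomputable def AS (t q : ℝ) : PowerSeries ℝ := PowerSeries.mk fun n => aP ℝ t q n / qf q n

/-- normalised generating series over PRW -/
noncomputable def PS (t q : ℝ) : PowerSeries ℝ := PowerSeries.mk fun n => pP ℝ t q (n + 1) / qf q n

open PowerSeries in
lemma coeff_U (t q : ℝ) (r : ℕ) : coeff r (1 + C t * (AS t q - 1)) =
    (if 0 < r then t else 1) * (aP ℝ t q r / qf q r) := by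
  cases r with
  | zero => simp [AS, aP_zero, qf_zero]
  | succ r => simp [AS, coeff_one]

open PowerSeries in
lemma coeff_V (t q : ℝ) (r : ℕ) : coeff r (1 + C t * (rescale q (AS t q) - 1)) =
    (if 0 < r then t else 1) * q ^ r * (aP ℝ t q r / qf q r) := by
  cases r with
  | zero => simp [AS, aP_zero, qf_zero, cc_rescale]
  | succ r => simp [AS, coeff_one, coeff_rescale]; ring

open PowerSeries in
lemma AS_eq {q : ℝ} (t : ℝ) (h0 : 0 < q) (h1 : q < 1) :
    AS t q - rescale q (AS t q) = X * (AS t q + C t * (AS t q - 1) * rescale q (AS t q)) := by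
  have e : AS t q + C t * (AS t q - 1) * rescale q (AS t q) =
    1 * (1 + C t * (AS t q - 1)) + (AS t q - 1) * (1 + C t * (rescale q (AS t q) - 1)) := by ring
  rw [e]
  ext n
  cases n with
  | zero => simp [AS, cc_rescale]
  | succ n =>
    rw [coeff_succ_X_mul, map_sub, coeff_rescale, map_add, coeff_mul, coeff_mul, ← Finset.sum_add_distrib]
    have a := (qf_pos h0 h1 n).ne'
    have b := (qf_pos h0 h1 (n + 1)).ne'
    have hl : coeff (n + 1) (AS t q) - q ^ (n + 1) * coeff (n + 1) (AS t q) = aP ℝ t q (n + 1) / qf q n := by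
      rw [AS, coeff_mk]
      rw [qf_succ] at *
      have c : (1 - q ^ (n + 1)) ≠ 0 := right_ne_zero_of_mul b
      field_simp
    rw [hl, rec_a, Finset.sum_div]
    refine Finset.sum_congr rfl fun p hp => ?_
    rw [gauss_qf h0 h1 n p.1 p.2 (mem_antidiagonal.1 hp), coeff_U, coeff_V]
    obtain ⟨k, r⟩ := p
    have c := (qf_pos h0 h1 k).ne'
    have d := (qf_pos h0 h1 r).ne'
    simp only
    cases k with
    | zero => by_cases hr : 0 < r <;> simp [AS, aP_zero, qf_zero, hr] <;> field_simp
    | succ k => by_cases hr : 0 < r <;> simp [AS, coeff_one, hr] <;> field_simp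

open PowerSeries in
lemma PS_eq {q : ℝ} (t : ℝ) (h0 : 0 < q) (h1 : q < 1) :
    PS t q - rescale q (PS t q) = X * (PS t q * (1 + C t * rescale q (AS t q))) := by
  have e : PS t q * (1 + C t * rescale q (AS t q)) =
    C t * PS t q + PS t q * (1 + C t * (rescale q (AS t q) - 1)) := by ring
  rw [e]
  ext n
  cases n with
  | zero => simp [PS, cc_rescale]
  | succ n =>
    rw [coeff_succ_X_mul, map_sub, coeff_rescale, map_add, coeff_C_mul, coeff_mul]
    have a := (qf_pos h0 h1 n).ne'
    have b := (qf_pos h0 h1 (n + 1)).ne'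
    have hl : coeff (n + 1) (PS t q) - q ^ (n + 1) * coeff (n + 1) (PS t q) = pP ℝ t q (n + 1 + 1) / qf q n := by
      rw [PS, coeff_mk]
      rw [qf_succ] at *
      have c : (1 - q ^ (n + 1)) ≠ 0 := right_ne_zero_of_mul b
      field_simp
    rw [hl, rec_p, add_div, Finset.sum_div]
    congr 1
    · rw [PS, coeff_mk, mul_div_assoc]
    refine Finset.sum_congr rfl fun p hp => ?_
    rw [gauss_qf h0 h1 n p.1 p.2 (mem_antidiagonal.1 hp), coeff_V, PS, coeff_mk]
    have c := (qf_pos h0 h1 p.1).ne'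
    have d := (qf_pos h0 h1 p.2).ne'
    field_simp

open PowerSeries in
lemma AS_closed {q : ℝ} (t : ℝ) (h0 : 0 < q) (h1 : q < 1) :
    AS t q * (rescale t (eS q) - C t * eS q) = C (1 - t) * eS q := by
  rw [← sub_eq_zero]
  refine ser_uniq h0 h1 _ (1 + C t * rescale q (AS t q)) ?_ ?_
  · have e1 := eS_eq h0 h1
    have e2 : rescale t (eS q) - rescale q (rescale t (eS q)) = C t * X * rescale t (eS q) := by
      have := congrArg (rescale t) e1
      rw [map_sub, map_mul, rescale_X, rescale_rescale, mul_comm] at this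
      rw [rescale_rescale]
      exact this
    have e3 := AS_eq t h0 h1
    have hC : ∀ a : ℝ, rescale q (C a) = C a := fun a => by
      ext n; rw [coeff_rescale, coeff_C]; split_ifs with h <;> simp [h]
    simp only [map_sub, map_mul, hC, map_one]
    set A := AS t q
    set S := rescale q A
    set e := eS q
    set F := rescale t e
    have e1' : rescale q e = e - X * e := by rw [← e1]; ring
    have e2' : rescale q F = F - C t * X * F := by rw [← e2]; ring
    rw [e1', e2']
    linear_combination (F - C t * e) * e3
  · simp [AS, eS, aP_zero, qf_zero, cc_rescale]

open PowerSeries in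
lemma aP_eq {q t : ℝ} (h0 : 0 < q) (h1 : q < 1) (ht : t ≠ 1) (n : ℕ) : aP ℝ t q n = Aq ℝ n t q := by
  have h : AS t q = mk (fun n => Aq ℝ n t q / qf q n) := by
    refine mul_right_cancel₀ (b := rescale t (eS q) - C t * eS q) ?_ ((AS_closed t h0 h1).trans (Ehat_eq t h0 h1).symm)
    intro h
    have := congrArg (coeff 0) h
    simp [eS, qf_zero, cc_rescale] at this
    exact ht (by linarith)
  have := congrArg (coeff n) h
  rw [AS, coeff_mk, coeff_mk] at this
  exact (div_left_inj' (qf_pos h0 h1 n).ne').1 this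

open PowerSeries in
lemma PS_closed {q : ℝ} (t : ℝ) (h0 : 0 < q) (h1 : q < 1) :
    PS t q = eS q * (1 + C t * (AS t q - 1)) := by
  rw [← sub_eq_zero]
  refine ser_uniq h0 h1 _ (1 + C t * rescale q (AS t q)) ?_ ?_
  · have e1 := eS_eq h0 h1
    have e3 := AS_eq t h0 h1
    have e4 := PS_eq t h0 h1
    have hC : ∀ a : ℝ, rescale q (C a) = C a := fun a => by
      ext n; rw [coeff_rescale, coeff_C]; split_ifs with h <;> simp [h]
    simp only [map_sub, map_mul, map_add, hC, map_one]
    set A := AS t q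
    set S := rescale q A
    set e := eS q
    set P := PS t q
    have e1' : rescale q e = e - X * e := by rw [← e1]; ring
    have e4' : rescale q P = P - X * (P * (1 + C t * S)) := by rw [← e4]; ring
    rw [e1', e4']
    linear_combination (- C t * e) * e3
  · simp [AS, PS, eS, aP_zero, pP_one, qf_zero]

lemma sum_Icc_shift (f : ℕ → ℝ) (n : ℕ) : ∑ m ∈ Icc 1 n, f m = ∑ i ∈ range n, f (i + 1) := by
  induction n with
  | zero => simp
  | succ n ih => rw [Finset.sum_Icc_succ_top (by omega), ih, Finset.sum_range_succ]

open PowerSeries in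
lemma real_main {q t : ℝ} (h0 : 0 < q) (h1 : q < 1) (ht : t ≠ 1) (n : ℕ) :
    Atilde ℝ n t q = pP ℝ t q (n + 1) := by
  have h := congrArg (coeff n) (PS_closed t h0 h1)
  rw [mul_comm, coeff_mul, PS, coeff_mk, div_eq_iff (qf_pos h0 h1 n).ne'] at h
  have h2 : pP ℝ t q (n + 1) = ∑ p ∈ antidiagonal n, gaussR q n p.1 * ((if 0 < p.1 then t else 1) * Aq ℝ p.1 t q) := by
    rw [h, Finset.sum_mul]
    refine Finset.sum_congr rfl fun p hp => ?_
    rw [gauss_qf h0 h1 n p.1 p.2 (mem_antidiagonal.1 hp), coeff_U, eS, coeff_mk, aP_eq h0 h1 ht]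
    ring
  rw [h2, Finset.Nat.sum_antidiagonal_eq_sum_range_succ_mk, Finset.sum_range_succ', Atilde, sum_Icc_shift, Finset.mul_sum, add_comm]
  simp only [Nat.succ_pos, if_true, lt_irrefl, if_false, gauss_zero]
  rw [← aP_eq h0 h1 ht 0, aP_zero]
  congr 1
  · refine Finset.sum_congr rfl fun i _ => ?_
    ring
  · simp

lemma map_Aq {R S : Type*} [CommRing R] [CommRing S] (φ : R →+* S) (t q : R) (n : ℕ) :
    φ (Aq R n t q) = Aq S n (φ t) (φ q) := by
  simp [Aq]

lemma map_gauss {R S : Type*} [CommRing R] [CommRing S] (φ : R →+* S) (q : R) (n k : ℕ) :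
    φ (gaussR q n k) = gaussR (φ q) n k := by
  induction n generalizing k with
  | zero => cases k <;> simp [gaussR]
  | succ n ih => cases k <;> simp [gaussR, ih]

lemma map_Atilde {R S : Type*} [CommRing R] [CommRing S] (φ : R →+* S) (t q : R) (n : ℕ) :
    φ (Atilde R n t q) = Atilde S n (φ t) (φ q) := by
  simp [Atilde, map_Aq, map_gauss]

lemma map_pP {R S : Type*} [CommRing R] [CommRing S] (φ : R →+* S) (t q : R) (n : ℕ) :
    φ (pP R t q n) = pP S (φ t) (φ q) n := by
  simp [pP, apply_ite φ]

lemma poly_main (n : ℕ) : Atilde (MvPolynomial (Fin 2) ℝ) n (MvPolynomial.X 0) (MvPolynomial.X 1) =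
    pP (MvPolynomial (Fin 2) ℝ) (MvPolynomial.X 0) (MvPolynomial.X 1) (n + 1) := by
  refine MvPolynomial.funext_set (fun _ => Set.Ioo (0 : ℝ) 1) (fun _ => Set.Ioo_infinite one_pos) ?_
  intro x hx
  have hx0 := hx 0 (Set.mem_univ _)
  have hx1 := hx 1 (Set.mem_univ _)
  rw [map_Atilde, map_pP, MvPolynomial.eval_X, MvPolynomial.eval_X]
  exact real_main hx1.1 hx1.2 hx0.2.ne n

lemma int_main (n : ℕ) : Atilde (MvPolynomial (Fin 2) ℤ) n (MvPolynomial.X 0) (MvPolynomial.X 1) =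
    pP (MvPolynomial (Fin 2) ℤ) (MvPolynomial.X 0) (MvPolynomial.X 1) (n + 1) := by
  apply MvPolynomial.map_injective (Int.castRingHom ℝ) Int.cast_injective
  rw [map_Atilde, map_pP, MvPolynomial.map_X, MvPolynomial.map_X]
  exact poly_main n

lemma gen_main {R : Type*} [CommRing R] (t q : R) (n : ℕ) : Atilde R n t q = pP R t q (n + 1) := by
  have h := congrArg (MvPolynomial.eval₂Hom (Int.castRingHom R) ![t, q]) (int_main n)
  rw [map_Atilde, map_pP] at h
  simpa using h

end FinalAlg

/-- combinatorial interpretation of the q-binomial-Eulerian polynomial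
as the (des, ai)-generating polynomial over `PRW_{n+1}`. -/
theorem stmt9 {R : Type*} [CommRing R] (t q : R) (n : ℕ) (hn : 1 ≤ n) :
    Atilde R n t q =
      ∑ π ∈ Finset.univ.filter (fun π : Equiv.Perm (Fin (n + 1)) => isPRW π),
        t ^ desN π * q ^ aiN π := by
  rw [gen_main, pP, Finset.sum_filter]
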